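/- Let K be an algebraically closed field, V a smooth connected quasi-projective K-curve, and φ: V' → V a flat morphism of quasi-projective K-varieties with dense image. Let G be a finite group acting on V' by K-automorphisms such that φ is G-invariant. Let V̄ be the unique smooth projective K-curve containing V as a dense open subvariety. Then there exist a projective K-variety V̄' which is pure of dimension dim V', a locally closed immersion i': V' ↪ V̄', and a flat surjective morphism φ̄: V̄' → V̄ extending φ, such that every fibre of φ̄ is pure, and the G-action on V' extends to a G-action on V̄' by automorphisms for which φ̄ is G-invariant. -/

import Mathlib

open AlgebraicGeometry CategoryTheory CategoryTheory.Limits TopologicalSpace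

noncomputable section

namespace HLpaper

attribute [local instance] MvPolynomial.gradedAlgebra

/-- The spectrum of a commutative ring as a scheme. -/
abbrev SpecOf (K : Type) [CommRing K] : Scheme := Spec (CommRingCat.of K)

/-- Projective `n`-space over `K`, as `Proj` of the polynomial ring in `n+1` variables. -/
abbrev ProjSpace (K : Type) [CommRing K] (n : ℕ) : Scheme :=
  Proj (MvPolynomial.homogeneousSubmodule (Fin (n + 1)) K)

/-- The structure morphism of projective space over `K`. -/
def ProjSpace.structMap (K : Type) [CommRing K] (n : ℕ) :
    ProjSpace K n ⟶ SpecOf K :=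
  Proj.toSpecZero _ ≫ Spec.map (CommRingCat.ofHom
    (algebraMap K ↥(MvPolynomial.homogeneousSubmodule (Fin (n + 1)) K 0)))

/-- A `K`-variety: a reduced scheme, separated and of finite type over `Spec K`. -/
structure Variety (K : Type) [Field K] where
  X : Scheme
  structMap : X ⟶ SpecOf K
  reduced : IsReduced X
  separated : IsSeparated structMap
  locallyOfFiniteType : LocallyOfFiniteType structMap
  quasiCompact : QuasiCompact structMap

variable {K : Type} [Field K]

/-- The dimension of a variety, as the Krull dimension of its underlying space. -/
def Variety.dim (V : Variety K) : WithBot ℕ∞ := topologicalKrullDim V.X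

/-- A topological space is pure of dimension `d` if all its irreducible components
have dimension `d`. -/
def IsPureOfDim (α : Type*) [TopologicalSpace α] (d : WithBot ℕ∞) : Prop :=
  ∀ T ∈ irreducibleComponents α, topologicalKrullDim T = d

/-- A topological space is pure if all its irreducible components have the same dimension. -/
def IsPure (α : Type*) [TopologicalSpace α] : Prop := ∃ d, IsPureOfDim α d

/-- The (topological) fibre of a morphism of schemes over a point of the target. -/
def fiber {X Y : Scheme} (f : X ⟶ Y) (y : Y) : Set X := f.base ⁻¹' {y}

/-- A variety is quasi-projective if it admits a locally closed immersion
into some projective space over `K`. -/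
def Variety.IsQuasiProjective (V : Variety K) : Prop :=
  ∃ (n : ℕ) (i : V.X ⟶ ProjSpace K n),
    IsImmersion i ∧ i ≫ ProjSpace.structMap K n = V.structMap

/-- A variety is projective if it admits a closed immersion
into some projective space over `K`. -/
def Variety.IsProjective (V : Variety K) : Prop :=
  ∃ (n : ℕ) (i : V.X ⟶ ProjSpace K n),
    IsClosedImmersion i ∧ i ≫ ProjSpace.structMap K n = V.structMap

/-- An action of a group `G` on a variety `V` by `K`-automorphisms. -/
structure ActionOn (G : Type) [Group G] (V : Variety K) where
  ρ : G →* Aut V.X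
  over' : ∀ g : G, (ρ g).hom ≫ V.structMap = V.structMap

/-- A morphism is invariant under a group action on its source. -/
def ActionOn.Invariant {G : Type} [Group G] {V : Variety K} (σ : ActionOn G V)
    {Y : Scheme} (φ : V.X ⟶ Y) : Prop :=
  ∀ g : G, (σ.ρ g).hom ≫ φ = φ

/-- Flatness for a morphism of schemes: all induced maps on stalks are flat ring maps. -/
def SchemeFlat {X Y : Scheme} (f : X ⟶ Y) : Prop :=
  ∀ x : X, RingHom.Flat (f.stalkMap x).hom

theorem ringKrullDim_eq_of_integral {R S : Type} [CommRing R] [CommRing S] [Algebra R S]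
    [FaithfulSMul R S] [Algebra.IsIntegral R S] : ringKrullDim S = ringKrullDim R := by
  apply le_antisymm
  · refine Order.krullDim_le_of_strictMono (PrimeSpectrum.comap (algebraMap R S)) ?_
    intro p q hpq
    exact Ideal.IsIntegral.comap_lt_comap (R := R) (I := p.asIdeal) (J := q.asIdeal) hpq
  · refine iSup_le fun l => ?_
    obtain ⟨P, -, hP, hPl⟩ := Ideal.exists_ideal_over_prime_of_isIntegral (S := S)
      (RelSeries.head l).asIdeal ⊥ (by
        rw [← RingHom.ker_eq_comap_bot,
          (RingHom.injective_iff_ker_eq_bot _).mp (FaithfulSMul.algebraMap_injective R S)]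
        exact bot_le)
    have : P.LiesOver (RelSeries.head l).asIdeal := ⟨hPl.symm⟩
    obtain ⟨L, hL, -⟩ := Ideal.exists_ltSeries_of_hasGoingUp l P
    rw [← hL]
    exact le_iSup (fun p : LTSeries (PrimeSpectrum S) => (p.length : WithBot ℕ∞)) L

theorem height_maximal_mvPolynomial (k : Type) [Field k] (n : ℕ) :
    ∀ m : Ideal (MvPolynomial (Fin n) k), m.IsMaximal → m.height = n := by
  induction n with
  | zero =>
    intro m hm
    have e := MvPolynomial.isEmptyRingEquiv k (Fin 0)
    have h : IsField (MvPolynomial (Fin 0) k) := MulEquiv.isField (Field.toIsField k) e.toMulEquiv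
    let := h.toField
    have : m = ⊥ := (Ideal.eq_bot_or_top m).resolve_right hm.ne_top
    subst this
    simp
  | succ n ih =>
    intro m hm
    let e := (MvPolynomial.finSuccEquiv k n).toRingEquiv
    rw [← e.height_map]
    have : (m.map e).IsMaximal := Ideal.map_isMaximal_of_equiv e
    set P := m.map e
    let p := P.comap (Polynomial.C : MvPolynomial (Fin n) k →+* _)
    have : P.LiesOver p := ⟨rfl⟩
    have hp : p.IsMaximal := Polynomial.isMaximal_comap_C_of_isJacobsonRing P
    rw [Polynomial.height_eq_height_add_one p P, ih p hp]
    simp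

theorem dim_trdeg (k A : Type) [Field k] [CommRing A] [IsDomain A] [Algebra k A]
    [Algebra.FiniteType k A] :
    ∃ s : ℕ, ringKrullDim A = s ∧ Algebra.trdeg k A = s := by
  obtain ⟨s, g, hg, hInt⟩ := exists_integral_inj_algHom_of_fg k A
  let := g.toRingHom.toAlgebra
  have : Algebra.IsIntegral (MvPolynomial (Fin s) k) A := ⟨hInt⟩
  have : FaithfulSMul (MvPolynomial (Fin s) k) A := (faithfulSMul_iff_algebraMap_injective _ _).2 hg
  have : IsScalarTower k (MvPolynomial (Fin s) k) A := IsScalarTower.of_algebraMap_eq' g.comp_algebraMap.symm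
  refine ⟨s, ?_, ?_⟩
  · rw [ringKrullDim_eq_of_integral (R := MvPolynomial (Fin s) k),
      MvPolynomial.ringKrullDim_of_isNoetherianRing]
    simp [ringKrullDim_eq_zero_of_field]
  · rw [← trdeg_add_eq k (MvPolynomial (Fin s) k) (A := A), trdeg_eq_zero (R := MvPolynomial (Fin s) k) (A := A),
      MvPolynomial.trdeg_of_isDomain]
    simp

theorem dim_quotient_height_one (k A : Type) [Field k] [CommRing A] [IsDomain A] [Algebra k A]
    [Algebra.FiniteType k A] (q : Ideal A) [q.IsPrime] (hq : q.height = 1) :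
    ringKrullDim (A ⧸ q) + 1 = ringKrullDim A := by
  obtain ⟨s, g, hg, hInt⟩ := exists_integral_inj_algHom_of_fg k A
  let := g.toRingHom.toAlgebra
  set R := MvPolynomial (Fin s) k
  have : Algebra.IsIntegral R A := ⟨hInt⟩
  have : FaithfulSMul R A := (faithfulSMul_iff_algebraMap_injective _ _).2 hg
  have : IsNoetherianRing A := Algebra.FiniteType.isNoetherianRing k A
  let p := q.under R
  have : q.LiesOver p := ⟨rfl⟩
  have hp : p.height = 1 := by
    apply le_antisymm
    · rw [← hq, Ideal.height_eq_height_add_of_liesOver_of_hasGoingDown p q]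
      exact le_self_add
    · rw [ENat.one_le_iff_ne_zero, Ne, Ideal.height_eq_zero_iff_eq_bot]
      exact Ideal.IsIntegral.comap_ne_bot R (Ideal.ne_bot_of_height_eq_one hq)
  have hpb : p ≠ ⊥ := Ideal.ne_bot_of_height_eq_one hp
  obtain ⟨f, hf, hfp⟩ := Ideal.IsPrime.exists_mem_prime_of_ne_bot (I := p) inferInstance hpb
  have hpf := Ideal.eq_span_singleton_of_height_eq_one hp hf hfp
  have h1 : ringKrullDim (A ⧸ q) = ringKrullDim (R ⧸ p) := ringKrullDim_eq_of_integral
  rw [h1, ringKrullDim_eq_of_integral (R := R) (S := A), hpf]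
  apply le_antisymm
  · exact ringKrullDim_quotient_succ_le_of_nonZeroDivisor (mem_nonZeroDivisors_of_ne_zero hfp.ne_zero)
  · obtain ⟨m, hm, hpm⟩ := Ideal.exists_le_maximal p (Ideal.IsPrime.ne_top inferInstance)
    have := Ideal.height_le_ringKrullDim_quotient_add_one (hpm hf)
    rw [height_maximal_mvPolynomial k s m hm] at this
    refine le_trans ?_ this
    rw [MvPolynomial.ringKrullDim_of_isNoetherianRing]
    simp [ringKrullDim_eq_zero_of_field]

/-- graded lemma -/
lemma graded_height {P : Type*} [PartialOrder P] (h : P → ℕ) (hm : StrictMono h)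
    (hc : ∀ x y : P, y ⋖ x → h x = h y + 1) (c : ℕ) (hmin : ∀ x : P, IsMin x → h x = c) (z : P) :
    Order.height z + c = h z := by
  have key : ∀ n (z : P), h z = n → (Order.height z + c = n) := by
    intro n
    induction n using Nat.strong_induction_on with
    | _ n ih =>
      intro z hz
      by_cases hzm : IsMin z
      · rw [Order.height_eq_zero.mpr hzm, ← hz, hmin z hzm, zero_add]
      · obtain ⟨y0, hy0⟩ := not_isMin_iff.mp hzm
        -- choose y < z with maximal h
        have hex : ∃ m, ∃ y, y < z ∧ n - h y = m := ⟨_, y0, hy0, rfl⟩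
        classical
        obtain ⟨y, hyz, hy⟩ := Nat.find_spec hex
        have hmax : ∀ y', y' < z → h y' ≤ h y := by
          intro y' hy'
          have h1 := Nat.find_min' hex ⟨y', hy', rfl⟩
          have h2 := hm hy'
          have h3 := hm hyz
          omega
        have hcov : y ⋖ z := ⟨hyz, fun w hw1 hw2 => by
          have := hmax w hw2
          have := hm hw1
          omega⟩
        have h1 := hc z y hcov
        have h2 := ih (h y) (by omega) y rfl
        have h3 : Order.height z = Order.height y + 1 := by
          apply le_antisymm
          · rw [Order.height_le_iff']
            intro p hp
            by_cases hl : p.length = 0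
            · simp [hl]
            · have hlt : p.eraseLast.last < z := by
                rw [← hp]; exact p.eraseLast_last_rel_last hl
              have h4 := ih (h p.eraseLast.last) (by rw [← hz]; exact hm hlt) _ rfl
              have h5 := hmax _ hlt
              have h6 : Order.height p.eraseLast.last ≤ Order.height y := by
                have : Order.height p.eraseLast.last + c ≤ Order.height y + c := by
                  rw [h4, h2]; exact_mod_cast h5
                exact (ENat.add_le_add_iff_right (ENat.coe_ne_top c)).mp this
              have h7 := Order.length_le_height_last (p := p.eraseLast)
              have h8 : (p.length : ℕ∞) = (p.eraseLast.length : ℕ∞) + 1 := by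
                have : p.length = p.eraseLast.length + 1 := by
                  simp; omega
                exact_mod_cast this
              rw [h8]
              gcongr
              exact h7.trans h6
          · exact Order.height_add_one_le hyz
        rw [h3, add_right_comm, h2, ← hz, h1]; push_cast; rfl
  exact key _ z rfl

/-- between lemma -/
lemma between {P : Type*} [PartialOrder P] (h : P → ℕ) (hm : StrictMono h)
    (hc : ∀ x y : P, y ⋖ x → h x = h y + 1) (d : ℕ) (x z : P) (hxz : x ≤ z) (hx : h x ≤ d)
    (hz : d ≤ h z) : ∃ y, x ≤ y ∧ y ≤ z ∧ h y = d := by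
  classical
  have hex : ∃ m, ∃ y, x ≤ y ∧ y ≤ z ∧ d ≤ h y ∧ h y = m := ⟨_, z, hxz, le_rfl, hz, rfl⟩
  obtain ⟨y, hxy, hyz, hdy, hy⟩ := Nat.find_spec hex
  have hmin : ∀ y', x ≤ y' → y' ≤ z → d ≤ h y' → h y ≤ h y' := fun y' h1 h2 h3 => by
    rw [hy]; exact Nat.find_min' hex ⟨y', h1, h2, h3, rfl⟩
  refine ⟨y, hxy, hyz, ?_⟩
  by_contra hne
  have hlt : x < y := lt_of_le_of_ne hxy (by rintro rfl; omega)
  have hex2 : ∃ m, ∃ w, x ≤ w ∧ w < y ∧ h y - h w = m := ⟨_, x, le_rfl, hlt, rfl⟩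
  obtain ⟨w, hxw, hwy, hw⟩ := Nat.find_spec hex2
  have hcov : w ⋖ y := ⟨hwy, fun u hu1 hu2 => by
    have := Nat.find_min' hex2 ⟨u, hxw.trans hu1.le, hu2, rfl⟩
    have := hm hu1
    have := hm hu2
    omega⟩
  have h1 := hc _ _ hcov
  have h2 := hmin w hxw (hwy.le.trans hyz) (by omega)
  omega

/-- affine: height in Spec -/
lemma spec_height_eq (A : CommRingCat.{0}) (p : Spec A) :
    ((Order.height p : ℕ∞) : WithBot ℕ∞) = ringKrullDim (A ⧸ p.asIdeal) := by
  rw [← Order.height_orderIso (specOrderIsoPrimeSpectrum A), ringKrullDim_quotient,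
    Order.height_eq_krullDim_Iic]
  have : Set.Iic ((specOrderIsoPrimeSpectrum A) p) ≃o
      (PrimeSpectrum.zeroLocus (R := A) (p.asIdeal : Set A))ᵒᵈ :=
    { toFun := fun q => OrderDual.toDual ⟨OrderDual.ofDual q.1, q.2⟩
      invFun := fun q => ⟨OrderDual.toDual (OrderDual.ofDual q).1, (OrderDual.ofDual q).2⟩
      left_inv := fun q => rfl
      right_inv := fun q => rfl
      map_rel_iff' := Iff.rfl }
  rw [Order.krullDim_eq_of_orderIso this, Order.krullDim_orderDual]

/-- partial order on the points of a scheme -/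
@[reducible] def schemePO (X : Scheme.{0}) : PartialOrder X :=
  { (inferInstance : Preorder X) with
    le_antisymm := fun _ _ h1 h2 => (Specializes.antisymm h2 h1).eq }

/-- transcendence degree of the residue field -/
def dl {k : Type} [Field k] {X : Scheme.{0}} (f : X ⟶ SpecOf k) (x : X) : Cardinal :=
  @Algebra.trdeg k (X.residueField x) _ _
    (Spec.preimage (X.fromSpecResidueField x ≫ f)).hom.toAlgebra

lemma trdeg_congr {k : Type} [Field k] {A B : CommRingCat.{0}} (a : CommRingCat.of k ⟶ A)
    (b : CommRingCat.of k ⟶ B) (e : A ≅ B) (h : a ≫ e.hom = b) :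
    @Algebra.trdeg k A _ _ a.hom.toAlgebra = @Algebra.trdeg k B _ _ b.hom.toAlgebra := by
  let := a.hom.toAlgebra
  let := b.hom.toAlgebra
  exact AlgEquiv.trdeg_eq (AlgEquiv.ofRingEquiv (f := e.commRingCatIsoToRingEquiv) (fun r => by
    have := congr($h r); exact this))

lemma dl_comp {k : Type} [Field k] {X' X : Scheme.{0}} (g : X' ⟶ X) (f : X ⟶ SpecOf k) (x : X')
    [IsIso (g.residueFieldMap x)] : dl (g ≫ f) x = dl f (g x) := by
  symm
  refine trdeg_congr _ _ (asIso (g.residueFieldMap x)) ?_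
  apply Spec.map_injective
  simp only [Spec.map_comp, Spec.map_preimage, asIso_hom]
  rw [Scheme.Hom.SpecMap_residueFieldMap_fromSpecResidueField_assoc]

lemma dl_spec {k : Type} [Field k] (A : CommRingCat.{0}) (f : CommRingCat.of k ⟶ A) (p : Spec A) :
    dl (Spec.map f) p = @Algebra.trdeg k (A ⧸ p.asIdeal) _ _
      ((Ideal.Quotient.mk p.asIdeal).comp f.hom).toAlgebra := by
  have : p.asIdeal.IsPrime := PrimeSpectrum.isPrime p
  trans @Algebra.trdeg k p.asIdeal.ResidueField _ _ ((algebraMap A p.asIdeal.ResidueField).comp f.hom).toAlgebra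
  · refine trdeg_congr _ (f ≫ CommRingCat.ofHom (algebraMap A p.asIdeal.ResidueField)) (Scheme.Spec.residueFieldIso A p) ?_
    rw [← Iso.eq_comp_inv]
    apply Spec.map_injective
    rw [Spec.map_preimage, Spec.map_comp, Spec.map_comp, Scheme.Spec.map_residueFieldIso_inv_eq_fromSpecResidueField_assoc]
  · let := ((Ideal.Quotient.mk p.asIdeal).comp f.hom).toAlgebra
    let : Algebra k p.asIdeal.ResidueField := ((algebraMap A p.asIdeal.ResidueField).comp f.hom).toAlgebra
    have : IsScalarTower k (A ⧸ p.asIdeal) p.asIdeal.ResidueField := IsScalarTower.of_algebraMap_eq (fun r => rfl)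
    have : FaithfulSMul (A ⧸ p.asIdeal) p.asIdeal.ResidueField := (faithfulSMul_iff_algebraMap_injective _ _).mpr
      (IsFractionRing.injective _ _)
    have : FaithfulSMul k (A ⧸ p.asIdeal) := (faithfulSMul_iff_algebraMap_injective _ _).mpr
      (RingHom.injective _)
    have h0 := trdeg_add_eq k (A ⧸ p.asIdeal) (A := p.asIdeal.ResidueField)
    have : Algebra.IsAlgebraic (A ⧸ p.asIdeal) p.asIdeal.ResidueField := IsLocalization.isAlgebraic _ (nonZeroDivisors _)
    rw [trdeg_eq_zero (R := A ⧸ p.asIdeal), add_zero] at h0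
    exact h0.symm

/-- affine case: height equals transcendence degree -/
lemma spec_height_dl {k : Type} [Field k] (A : CommRingCat.{0}) (f : CommRingCat.of k ⟶ A)
    (hf : f.hom.FiniteType) (p : Spec A) :
    ∃ s : ℕ, Order.height p = s ∧ dl (Spec.map f) p = s := by
  have : p.asIdeal.IsPrime := PrimeSpectrum.isPrime p
  let := ((Ideal.Quotient.mk p.asIdeal).comp f.hom).toAlgebra
  have : Algebra.FiniteType k (A ⧸ p.asIdeal) :=
    RingHom.FiniteType.comp (RingHom.FiniteType.of_surjective _ Ideal.Quotient.mk_surjective) hf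
  obtain ⟨s, h1, h2⟩ := dim_trdeg k (A ⧸ p.asIdeal)
  refine ⟨s, ?_, ?_⟩
  · have := spec_height_eq A p
    rw [h1] at this
    exact_mod_cast this
  · rw [dl_spec]; exact h2

/-- height of a point of an open subscheme is at most that in the whole -/
lemma height_le_of_isOpenImmersion {U X : Scheme.{0}} (g : U ⟶ X) [IsOpenImmersion g] (x : U) :
    Order.height x ≤ Order.height (g x) := by
  refine Order.height_le_height_apply_of_strictMono _ ?_ x
  have he : Topology.IsInducing g := g.isOpenEmbedding.isInducing
  intro a b hab
  rw [lt_iff_le_not_ge] at hab ⊢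
  simp only [Scheme.le_iff_specializes] at hab ⊢
  rwa [he.specializes_iff, he.specializes_iff]

lemma exists_affine_specMap {k : Type} [Field k] {X : Scheme.{0}} (f : X ⟶ SpecOf k)
    [LocallyOfFiniteType f] (x : X) : ∃ (A : CommRingCat.{0}) (g : Spec A ⟶ X)
      (a : CommRingCat.of k ⟶ A), IsOpenImmersion g ∧ x ∈ Set.range g ∧ g ≫ f = Spec.map a ∧
      a.hom.FiniteType := by
  obtain ⟨A, g, hg, hx, -⟩ := Scheme.exists_affine_mem_range_and_range_subset (x := x) (U := ⊤) trivial
  refine ⟨A, g, Spec.preimage (g ≫ f), hg, hx, (Spec.map_preimage _).symm, ?_⟩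
  have : LocallyOfFiniteType (Spec.map (Spec.preimage (g ≫ f))) := by
    rw [Spec.map_preimage]; infer_instance
  rwa [HasRingHomProperty.Spec_iff (P := @LocallyOfFiniteType)] at this

/-- height equals transcendence degree -/
lemma height_dl {k : Type} [Field k] {X : Scheme.{0}} (f : X ⟶ SpecOf k)
    [LocallyOfFiniteType f] (x : X) : ∃ s : ℕ, Order.height x = s ∧ dl f x = s := by
  obtain ⟨A, g, a, hg, ⟨y, rfl⟩, h, ha⟩ := exists_affine_specMap f x
  obtain ⟨s, hs1, hs2⟩ := spec_height_dl A a ha y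
  rw [← h, dl_comp] at hs2
  refine ⟨s, le_antisymm ?_ ?_, hs2⟩
  · rw [Order.height_le_iff']
    intro p hp
    obtain ⟨A', g', a', hg', ⟨y', hy'⟩, h', ha'⟩ := exists_affine_specMap f p.head
    have hin : ∀ i, ∃ z, g' z = p i := by
      intro i
      have h1 : p i ⤳ p.head := p.head_le i
      have := h1.mem_open g'.isOpenEmbedding.isOpen_range ⟨y', hy'⟩
      exact this
    choose z hz using hin
    have he : Topology.IsInducing g' := g'.isOpenEmbedding.isInducing
    let p' : LTSeries (Spec A') := ⟨p.length, z, fun i => by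
      have h1 := p.step i
      change p.toFun i.castSucc < p.toFun i.succ at h1
      change z i.castSucc < z i.succ
      rw [lt_iff_le_not_ge] at h1 ⊢
      simp only [Scheme.le_iff_specializes] at h1 ⊢
      rwa [← he.specializes_iff, ← he.specializes_iff, hz, hz]⟩
    have h2 := Order.length_le_height_last (p := p')
    obtain ⟨s', hs1', hs2'⟩ := spec_height_dl A' a' ha' p'.last
    rw [← h', dl_comp] at hs2'
    have h3 : g' p'.last = g y := by rw [← hp]; exact hz _
    rw [h3, hs2] at hs2'
    have h4 : s = s' := by exact_mod_cast hs2'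
    rw [h4, ← hs1']
    exact h2
  · rw [← hs1]
    exact height_le_of_isOpenImmersion g y

lemma height_eq_of_residue {k : Type} [Field k] {X' X : Scheme.{0}} (g : X' ⟶ X) (f : X ⟶ SpecOf k)
    [LocallyOfFiniteType f] [LocallyOfFiniteType (g ≫ f)] (x : X')
    [IsIso (g.residueFieldMap x)] : Order.height (g x) = Order.height x := by
  obtain ⟨s, h1, h2⟩ := height_dl f (g x)
  obtain ⟨s', h1', h2'⟩ := height_dl (g ≫ f) x
  rw [dl_comp, h2] at h2'
  rw [h1, h1']
  exact_mod_cast h2'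

/-- covers raise the height by exactly one -/
lemma height_covBy {k : Type} [Field k] {X : Scheme.{0}} (f : X ⟶ SpecOf k)
    [LocallyOfFiniteType f] (x y : X) (hxy : y ⋖ x) : Order.height x = Order.height y + 1 := by
  obtain ⟨A, g, a, hg, ⟨y, rfl⟩, h, ha⟩ := exists_affine_specMap f y
  have hx : x ∈ Set.range g :=
    Specializes.mem_open (x := x) (y := g y) hxy.le g.isOpenEmbedding.isOpen_range ⟨y, rfl⟩
  obtain ⟨x, rfl⟩ := hx
  have : LocallyOfFiniteType (g ≫ f) := inferInstance
  rw [height_eq_of_residue g f, height_eq_of_residue g f]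
  have he : Topology.IsInducing g := g.isOpenEmbedding.isInducing
  have hle : ∀ u v, g u ≤ g v ↔ u ≤ v := fun u v => he.specializes_iff
  have hcov : y ⋖ x := by
    refine ⟨?_, fun w hw1 hw2 => ?_⟩
    · have := hxy.1
      rwa [lt_iff_le_not_ge, hle, hle, ← lt_iff_le_not_ge] at this
    · refine hxy.2 (c := g w) ?_ ?_
      · rwa [lt_iff_le_not_ge, hle, hle, ← lt_iff_le_not_ge]
      · rwa [lt_iff_le_not_ge, hle, hle, ← lt_iff_le_not_ge]
  have : x.asIdeal.IsPrime := PrimeSpectrum.isPrime x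
  have : y.asIdeal.IsPrime := PrimeSpectrum.isPrime y
  have hsp : ∀ u v : Spec A, u ≤ v ↔ v.asIdeal ≤ u.asIdeal := fun u v =>
    (specOrderIsoPrimeSpectrum A).le_iff_le.symm
  have hlt : x.asIdeal ≤ y.asIdeal := (hsp _ _).mp hcov.1.le
  let := ((Ideal.Quotient.mk x.asIdeal).comp a.hom).toAlgebra
  have : Algebra.FiniteType k (A ⧸ x.asIdeal) :=
    RingHom.FiniteType.comp (RingHom.FiniteType.of_surjective _ Ideal.Quotient.mk_surjective) ha
  let q : Ideal (A ⧸ x.asIdeal) := y.asIdeal.map (Ideal.Quotient.mk x.asIdeal)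
  have hq : q.IsPrime := Ideal.map_isPrime_of_surjective Ideal.Quotient.mk_surjective (by
    rwa [Ideal.mk_ker])
  have hcq : q.comap (Ideal.Quotient.mk x.asIdeal) = y.asIdeal := by
    rw [Ideal.comap_map_of_surjective _ Ideal.Quotient.mk_surjective, ← RingHom.ker_eq_comap_bot, Ideal.mk_ker]
    simpa using hlt
  have hq1 : q.height = 1 := by
    have hnb : ∀ r : Ideal (A ⧸ x.asIdeal), r ≠ ⊥ → ¬ r.comap (Ideal.Quotient.mk x.asIdeal) ≤ x.asIdeal := by
      intro r hr hle2
      apply hr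
      rw [← Ideal.map_comap_of_surjective (Ideal.Quotient.mk x.asIdeal) Ideal.Quotient.mk_surjective r,
        Ideal.map_eq_bot_iff_le_ker, Ideal.mk_ker]
      exact hle2
    apply le_antisymm
    · have : q.height ≤ (1 : ℕ) := by
        rw [Ideal.height_le_iff]
        intro r hr hrq
        rw [Nat.cast_one, ENat.lt_one_iff_eq_zero, Ideal.height_eq_zero_iff_eq_bot]
        by_contra hne
        have hrc : (r.comap (Ideal.Quotient.mk x.asIdeal)).IsPrime := inferInstance
        have hxr : x.asIdeal ≤ r.comap (Ideal.Quotient.mk x.asIdeal) := by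
          intro t ht
          rw [Ideal.mem_comap, Ideal.Quotient.eq_zero_iff_mem.mpr ht]
          exact zero_mem _
        let w : Spec A := (⟨_, hrc⟩ : PrimeSpectrum A)
        refine hcov.2 (c := w) ?_ ?_
        · rw [lt_iff_le_not_ge, hsp, hsp]
          refine ⟨hcq ▸ Ideal.comap_mono hrq.le, fun h2 => hrq.not_ge ?_⟩
          rw [Ideal.map_le_iff_le_comap]
          exact h2
        · rw [lt_iff_le_not_ge, hsp, hsp]
          exact ⟨hxr, hnb r hne⟩
      exact_mod_cast this
    · rw [Order.one_le_iff_ne_zero, Ne, Ideal.height_eq_zero_iff_eq_bot]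
      intro hb
      have h2 := hcov.1
      rw [lt_iff_le_not_ge, hsp, hsp] at h2
      apply h2.2
      rw [← hcq, hb, ← RingHom.ker_eq_comap_bot, Ideal.mk_ker]
  have h1 := dim_quotient_height_one k (A ⧸ x.asIdeal) q hq1
  have e : ((A ⧸ x.asIdeal) ⧸ q) ≃+* A ⧸ y.asIdeal :=
    DoubleQuot.quotQuotEquivQuotOfLE hlt
  rw [ringKrullDim_eq_of_ringEquiv e, ← spec_height_eq, ← spec_height_eq] at h1
  exact_mod_cast h1.symm

section topo
attribute [local instance] specializationOrder

lemma topDim_eq (α : Type*) [TopologicalSpace α] [QuasiSober α] [T0Space α] :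
    topologicalKrullDim α = Order.krullDim α :=
  Order.krullDim_eq_of_orderIso irreducibleSetEquivPoints

lemma topDim_of_embedding (α β : Type*) [TopologicalSpace α] [T0Space α] [TopologicalSpace β]
    [QuasiSober β] (f : β → α) (hf : Topology.IsEmbedding f) (x : α)
    (hx : ∀ y, y ∈ Set.range f ↔ x ⤳ y) :
    topologicalKrullDim β = ((@Order.height α (specializationPreorder α) x : ℕ∞) : WithBot ℕ∞) := by
  have : T0Space β := hf.t0Space
  rw [topDim_eq, Order.height_eq_krullDim_Iic]
  choose g hg using fun y : Set.Iic x => (hx y.1).mpr y.2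
  refine Order.krullDim_eq_of_orderIso
    { toFun := fun y => ⟨f y, (hx _).mp ⟨y, rfl⟩⟩
      invFun := g
      left_inv := fun y => hf.injective (hg _)
      right_inv := fun y => Subtype.ext (hg _)
      map_rel_iff' := ?_ }
  intro a b
  exact hf.isInducing.specializes_iff

lemma component_height (α : Type*) [TopologicalSpace α] [QuasiSober α] [T0Space α]
    (T : Set α) (hT : T ∈ irreducibleComponents α) :
    ∃ x : α, (∀ y, y ⤳ x → y = x) ∧
      topologicalKrullDim T = ((@Order.height α (specializationPreorder α) x : ℕ∞) : WithBot ℕ∞) := by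
  have hcl : IsClosed T := isClosed_of_mem_irreducibleComponents T hT
  have hirr : IsIrreducible T := hT.1
  obtain ⟨x, hx⟩ := QuasiSober.sober hirr hcl
  refine ⟨x, ?_, ?_⟩
  · intro y hy
    have h1 : T ⊆ closure {y} := by
      rw [← hx.def]; exact hy.closure_subset
    have h2 : closure {y} ⊆ T := hT.2 isIrreducible_singleton.closure h1
    have h3 : IsGenericPoint y T := h2.antisymm h1
    exact h3.eq hx
  · have : QuasiSober T := hcl.isClosedEmbedding_subtypeVal.quasiSober
    exact topDim_of_embedding α T Subtype.val Topology.IsEmbedding.subtypeVal x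
      (fun y => by rw [← hx.def]; simp [specializes_iff_mem_closure])
end topo

lemma exists_maximal_ge {X : Scheme.{0}} (x : X) :
    ∃ v : X, x ≤ v ∧ closure {v} ∈ irreducibleComponents X ∧ ∀ w, v ≤ w → w = v := by
  have h := irreducibleComponent_mem_irreducibleComponents x
  obtain ⟨v, hv⟩ := QuasiSober.sober h.1 (isClosed_of_mem_irreducibleComponents _ h)
  refine ⟨v, ?_, ?_, ?_⟩
  · have : x ∈ closure {v} := by rw [hv.def]; exact mem_irreducibleComponent
    exact specializes_iff_mem_closure.mpr this
  · rw [hv.def]; exact h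
  · intro w hw
    have h1 : irreducibleComponent x ⊆ closure {w} := by
      rw [← hv.def]; exact Specializes.closure_subset hw
    have h2 : closure {w} ⊆ irreducibleComponent x := h.2 isIrreducible_singleton.closure h1
    have h3 : IsGenericPoint w (irreducibleComponent x) := h2.antisymm h1
    exact h3.eq hv

lemma noetherianSpace_of_ft {k : Type} [Field k] {X : Scheme.{0}} (f : X ⟶ SpecOf k)
    [LocallyOfFiniteType f] [QuasiCompact f] : IsNoetherian X := by
  have : CompactSpace X := QuasiCompact.compactSpace_of_compactSpace f
  have : IsLocallyNoetherian X := LocallyOfFiniteType.isLocallyNoetherian f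
  exact {}

/-- the finite set of maximal points -/
lemma finite_maximal {k : Type} [Field k] {X : Scheme.{0}} (f : X ⟶ SpecOf k)
    [LocallyOfFiniteType f] [QuasiCompact f] : {v : X | ∀ w, v ≤ w → w = v}.Finite := by
  have := noetherianSpace_of_ft f
  have h : (irreducibleComponents X).Finite := NoetherianSpace.finite_irreducibleComponents
  refine Set.Finite.of_finite_image (f := fun v : X => closure {v}) (h.subset ?_) ?_
  · rintro _ ⟨v, hv, rfl⟩
    obtain ⟨w, h1, h2, h3⟩ := exists_maximal_ge v
    rw [hv w h1] at h2
    exact h2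
  · intro a _ b _ hab
    have h1 : IsGenericPoint a (closure {b}) := hab
    exact h1.eq rfl

lemma exists_dim {k : Type} [Field k] {X : Scheme.{0}} (f : X ⟶ SpecOf k)
    [LocallyOfFiniteType f] [QuasiCompact f] [Nonempty X] :
    ∃ d : ℕ, topologicalKrullDim X = d ∧ (∀ x : X, Order.height x ≤ d) ∧ ∃ x : X, Order.height x = d := by
  classical
  have hfin := finite_maximal f
  choose h hh _ using height_dl f
  obtain ⟨v0, -, -, hv0⟩ := exists_maximal_ge (Classical.arbitrary X)
  obtain ⟨v, hv, hmax⟩ := Set.exists_max_image _ h hfin ⟨v0, hv0⟩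
  have hle : ∀ x : X, Order.height x ≤ h v := by
    intro x
    obtain ⟨w, h1, _, h2⟩ := exists_maximal_ge x
    refine (Order.height_mono h1).trans ?_
    rw [hh]
    exact_mod_cast hmax w h2
  refine ⟨h v, ?_, hle, v, hh v⟩
  rw [topDim_eq]
  apply le_antisymm
  · rw [Order.krullDim_eq_iSup_height_of_nonempty]
    exact_mod_cast iSup_le hle
  · have : ((Order.height v : ℕ∞) : WithBot ℕ∞) ≤ Order.krullDim X := Order.height_le_krullDim v
    rw [hh] at this
    exact this

section Segre
open HomogeneousLocalization

theorem eval₂_smul_homog {k R σ : Type} [CommRing k] [CommRing R] (κ : k →+* R) (u : R) (a : σ → R)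
    {m : ℕ} {F : MvPolynomial σ k} (hF : F ∈ MvPolynomial.homogeneousSubmodule σ k m) :
    F.eval₂ κ (fun i => u * a i) = u ^ m * F.eval₂ κ a := by
  rw [MvPolynomial.eval₂_eq, MvPolynomial.eval₂_eq, Finset.mul_sum]
  refine Finset.sum_congr rfl fun d hd => ?_
  have h := hF (MvPolynomial.mem_support_iff.mp hd)
  simp only [mul_pow, Finset.prod_mul_distrib]
  rw [Finset.prod_pow_eq_pow_sum]
  have : ∑ i ∈ d.support, d i = m := by
    rw [← h]; simp [Finsupp.weight_apply, Finsupp.sum]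
  rw [this]; ring

variable {k : Type} [CommRing k] {n : ℕ}

/-- evaluation of degree zero fractions at a vector where the denominator is invertible -/
def evA {R : Type} [CommRing R] (κ : k →+* R) (a : Fin (n + 1) → R)
    (f : MvPolynomial (Fin (n + 1)) k) (hu : IsUnit (f.eval₂ κ a)) :
    Away (MvPolynomial.homogeneousSubmodule (Fin (n + 1)) k) f →+* R :=
  (IsLocalization.Away.lift (S := Localization.Away f) f
    (g := MvPolynomial.eval₂Hom κ a)
    (show IsUnit (MvPolynomial.eval₂Hom κ a f) from hu)).comp (algebraMap _ (Localization.Away f))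

theorem evA_mk {R : Type} [CommRing R] (κ : k →+* R) (a : Fin (n + 1) → R)
    (f : MvPolynomial (Fin (n + 1)) k) (hu : IsUnit (f.eval₂ κ a)) {m : ℕ}
    (hf : f ∈ MvPolynomial.homogeneousSubmodule (Fin (n + 1)) k m) (e : ℕ)
    (F : MvPolynomial (Fin (n + 1)) k) (hF) :
    evA κ a f hu (Away.mk _ hf e F hF) * (f.eval₂ κ a) ^ e = F.eval₂ κ a := by
  simp only [evA, RingHom.comp_apply, HomogeneousLocalization.algebraMap_apply, Away.val_mk]
  have h1 : (Localization.mk F (⟨f ^ e, by use e⟩ : Submonoid.powers f)) *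
      algebraMap _ (Localization.Away f) (f ^ e) = algebraMap _ (Localization.Away f) F := by
    rw [Localization.mk_eq_mk']
    exact IsLocalization.mk'_spec _ F (⟨f ^ e, by use e⟩ : Submonoid.powers f)
  have h2 := congrArg (IsLocalization.Away.lift (S := Localization.Away f) f
    (g := MvPolynomial.eval₂Hom κ a) (show IsUnit (MvPolynomial.eval₂Hom κ a f) from hu)) h1
  rw [map_mul, IsLocalization.Away.lift_eq, IsLocalization.Away.lift_eq] at h2
  simpa using h2

theorem evA_ext {R : Type} [CommRing R] (κ : k →+* R) (a : Fin (n + 1) → R)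
    (f : MvPolynomial (Fin (n + 1)) k) (hu : IsUnit (f.eval₂ κ a)) {m : ℕ}
    (hf : f ∈ MvPolynomial.homogeneousSubmodule (Fin (n + 1)) k m)
    (ψ : Away (MvPolynomial.homogeneousSubmodule (Fin (n + 1)) k) f →+* R)
    (h : ∀ e F hF, ψ (Away.mk _ hf e F hF) * (f.eval₂ κ a) ^ e = F.eval₂ κ a) :
    ψ = evA κ a f hu := by
  ext z
  obtain ⟨e, F, hF, rfl⟩ := Away.mk_surjective _ hf z
  have := (h e F hF).trans (evA_mk κ a f hu hf e F hF).symm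
  exact (hu.pow e).mul_right_cancel this

/-- the point with homogeneous coordinates `a` -/
def ptf {R : CommRingCat.{0}} (κ : k →+* R) (a : Fin (n + 1) → R)
    (f : MvPolynomial (Fin (n + 1)) k) {m : ℕ}
    (hf : f ∈ MvPolynomial.homogeneousSubmodule (Fin (n + 1)) k m) (hm : 0 < m)
    (hu : IsUnit (f.eval₂ κ a)) : Spec R ⟶ ProjSpace k n :=
  Spec.map (CommRingCat.ofHom (evA κ a f hu)) ≫ Proj.awayι _ f hf hm

theorem ptf_map {R S : CommRingCat.{0}} (φ : R ⟶ S) (κ : k →+* R) (a : Fin (n + 1) → R)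
    (f : MvPolynomial (Fin (n + 1)) k) {m : ℕ}
    (hf : f ∈ MvPolynomial.homogeneousSubmodule (Fin (n + 1)) k m) (hm : 0 < m)
    (hu : IsUnit (f.eval₂ κ a)) (hu' : IsUnit (f.eval₂ (φ.hom.comp κ) (fun i => φ.hom (a i)))) :
    Spec.map φ ≫ ptf κ a f hf hm hu = ptf (φ.hom.comp κ) (fun i => φ.hom (a i)) f hf hm hu' := by
  rw [ptf, ptf, ← Category.assoc, ← Spec.map_comp]
  congr 2
  ext1
  refine evA_ext _ _ f hu' hf _ fun e F hF => ?_
  have := congrArg φ.hom (evA_mk κ a f hu hf e F hF)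
  rw [map_mul, map_pow, MvPolynomial.hom_eval₂, MvPolynomial.hom_eval₂] at this
  exact this

theorem ptf_mul {R : CommRingCat.{0}} (κ : k →+* R) (a : Fin (n + 1) → R)
    (f g : MvPolynomial (Fin (n + 1)) k) {m m' : ℕ}
    (hf : f ∈ MvPolynomial.homogeneousSubmodule (Fin (n + 1)) k m) (hm : 0 < m)
    (hg : g ∈ MvPolynomial.homogeneousSubmodule (Fin (n + 1)) k m')
    (hu : IsUnit (f.eval₂ κ a)) (x) (hx : x = f * g) (hu' : IsUnit (x.eval₂ κ a)) :
    ptf κ a x (hx ▸ SetLike.mul_mem_graded hf hg) (hm.trans_le (m.le_add_right m')) hu' =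
      ptf κ a f hf hm hu := by
  rw [ptf, ptf, ← Proj.SpecMap_awayMap_awayι _ hf hm hg hx, ← Category.assoc, ← Spec.map_comp]
  congr 2
  ext1
  refine evA_ext _ _ f hu hf _ fun e F hF => ?_
  rw [CommRingCat.hom_comp, CommRingCat.hom_ofHom, CommRingCat.hom_ofHom, RingHom.comp_apply,
    awayMap_mk]
  have h := evA_mk κ a x hu' (hx ▸ SetLike.mul_mem_graded hf hg) e (F * g ^ e)
    (by rw [smul_add]; exact SetLike.mul_mem_graded hF (SetLike.pow_mem_graded _ hg))
  have hug : IsUnit (g.eval₂ κ a) := by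
    rw [hx, MvPolynomial.eval₂_mul] at hu'
    exact isUnit_of_mul_isUnit_right hu'
  have hxx : x.eval₂ κ a = f.eval₂ κ a * g.eval₂ κ a := by rw [hx, MvPolynomial.eval₂_mul]
  rw [hxx, MvPolynomial.eval₂_mul, MvPolynomial.eval₂_pow, mul_pow, ← mul_assoc] at h
  exact (hug.pow e).mul_right_cancel h

theorem ptf_deg {R : CommRingCat.{0}} (κ : k →+* R) (a : Fin (n + 1) → R)
    (f : MvPolynomial (Fin (n + 1)) k) {m m' : ℕ} (h : m = m')
    (hf : f ∈ MvPolynomial.homogeneousSubmodule (Fin (n + 1)) k m) (hm : 0 < m)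
    (hf' : f ∈ MvPolynomial.homogeneousSubmodule (Fin (n + 1)) k m') (hm' : 0 < m')
    (hu : IsUnit (f.eval₂ κ a)) :
    ptf κ a f hf hm hu = ptf κ a f hf' hm' hu := by
  subst h; rfl

theorem ptf_indep {R : CommRingCat.{0}} (κ : k →+* R) (a : Fin (n + 1) → R)
    (f g : MvPolynomial (Fin (n + 1)) k) {m m' : ℕ}
    (hf : f ∈ MvPolynomial.homogeneousSubmodule (Fin (n + 1)) k m) (hm : 0 < m)
    (hg : g ∈ MvPolynomial.homogeneousSubmodule (Fin (n + 1)) k m') (hm' : 0 < m')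
    (hu : IsUnit (f.eval₂ κ a)) (hv : IsUnit (g.eval₂ κ a)) :
    ptf κ a f hf hm hu = ptf κ a g hg hm' hv := by
  have hx : IsUnit ((f * g).eval₂ κ a) := by rw [MvPolynomial.eval₂_mul]; exact hu.mul hv
  rw [← ptf_mul κ a f g hf hm hg hu (f * g) rfl hx,
    ← ptf_mul κ a g f hg hm' hf hv (f * g) (mul_comm _ _) hx]
  exact ptf_deg _ _ _ (add_comm _ _) _ _ _ _ _

theorem ptf_smul {R : CommRingCat.{0}} (κ : k →+* R) (a : Fin (n + 1) → R) (u : R) (huu : IsUnit u)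
    (f : MvPolynomial (Fin (n + 1)) k) {m : ℕ}
    (hf : f ∈ MvPolynomial.homogeneousSubmodule (Fin (n + 1)) k m) (hm : 0 < m)
    (hu : IsUnit (f.eval₂ κ a)) (hu' : IsUnit (f.eval₂ κ (fun i => u * a i))) :
    ptf κ a f hf hm hu = ptf κ (fun i => u * a i) f hf hm hu' := by
  rw [ptf, ptf]
  congr 3
  refine evA_ext _ _ f hu' hf _ fun e F hF => ?_
  rw [eval₂_smul_homog κ u a hf, eval₂_smul_homog κ u a hF, ← evA_mk κ a f hu hf e F hF, mul_pow,
    ← pow_mul, smul_eq_mul, mul_comm e m]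
  ring

theorem X_deg (i : Fin (n + 1)) : (MvPolynomial.X i : MvPolynomial (Fin (n + 1)) k) ∈
    MvPolynomial.homogeneousSubmodule (Fin (n + 1)) k 1 := MvPolynomial.isHomogeneous_X k i

/-- `f` is the point with homogeneous coordinates `a`. -/
def Rep {R : CommRingCat.{0}} (κ : k →+* R) (a : Fin (n + 1) → R) (f : Spec R ⟶ ProjSpace k n) : Prop :=
  ∃ (i : Fin (n + 1)) (hu : IsUnit ((MvPolynomial.X i).eval₂ κ a)),
    f = ptf κ a (MvPolynomial.X i) (X_deg i) one_pos hu

theorem Rep.unique {R : CommRingCat.{0}} {κ : k →+* R} {a : Fin (n + 1) → R}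
    {f g : Spec R ⟶ ProjSpace k n} (hf : Rep κ a f) (hg : Rep κ a g) : f = g := by
  obtain ⟨i, hu, rfl⟩ := hf
  obtain ⟨j, hv, rfl⟩ := hg
  apply ptf_indep

theorem Rep.map {R S : CommRingCat.{0}} {κ : k →+* R} {a : Fin (n + 1) → R}
    {f : Spec R ⟶ ProjSpace k n} (hf : Rep κ a f) (φ : R ⟶ S) :
    Rep (φ.hom.comp κ) (fun i => φ.hom (a i)) (Spec.map φ ≫ f) := by
  obtain ⟨i, hu, rfl⟩ := hf
  have hu' : IsUnit ((MvPolynomial.X i).eval₂ (φ.hom.comp κ) (fun i => φ.hom (a i))) := by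
    have := hu.map φ.hom
    simpa using this
  exact ⟨i, hu', ptf_map _ _ _ _ _ _ _ _⟩

theorem Rep.smul {R : CommRingCat.{0}} {κ : k →+* R} {a : Fin (n + 1) → R}
    {f : Spec R ⟶ ProjSpace k n} (hf : Rep κ a f) {u : R} (hu : IsUnit u) :
    Rep κ (fun i => u * a i) f := by
  obtain ⟨i, hui, rfl⟩ := hf
  have hu' : IsUnit ((MvPolynomial.X i).eval₂ κ (fun i => u * a i)) := by
    simp only [MvPolynomial.eval₂_X] at hui ⊢
    exact hu.mul hui
  exact ⟨i, hu', ptf_smul _ _ _ hu _ _ _ _ _⟩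

theorem Rep.exists_of_isUnit {R : CommRingCat.{0}} {κ : k →+* R} {a : Fin (n + 1) → R}
    (i : Fin (n + 1)) (h : IsUnit (a i)) : ∃ f : Spec R ⟶ ProjSpace k n, Rep κ a f :=
  ⟨_, i, by simpa using h, rfl⟩

theorem Rep.isUnit {R : CommRingCat.{0}} {κ : k →+* R} {a : Fin (n + 1) → R}
    {f : Spec R ⟶ ProjSpace k n} (hf : Rep κ a f) : ∃ i, IsUnit (a i) := by
  obtain ⟨i, h, _⟩ := hf
  exact ⟨i, by simpa using h⟩

theorem Rep.structMap {R : CommRingCat.{0}} {κ : k →+* R} {a : Fin (n + 1) → R}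
    {f : Spec R ⟶ ProjSpace k n} (hf : Rep κ a f) :
    f ≫ ProjSpace.structMap k n = Spec.map (CommRingCat.ofHom κ) := by
  obtain ⟨i, h, rfl⟩ := hf
  rw [ptf, ProjSpace.structMap, Category.assoc, Proj.awayι_toSpecZero_assoc, ← Spec.map_comp,
    ← Spec.map_comp]
  congr 1
  ext z
  have := evA_mk κ a (MvPolynomial.X i) h (X_deg i) 0 (MvPolynomial.C z)
    (by rw [zero_smul]; exact MvPolynomial.isHomogeneous_C _ _)
  rw [pow_zero, mul_one, MvPolynomial.eval₂_C] at this
  refine Eq.trans ?_ this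
  simp only [CommRingCat.hom_comp, CommRingCat.hom_ofHom, RingHom.comp_apply]
  congr 1

end Segre

section Segre
open HomogeneousLocalization

variable {k : Type} [CommRing k] {n : ℕ}

theorem evA_surj {R : Type} [CommRing R] (i : Fin (n + 1))
    (ψ : Away (MvPolynomial.homogeneousSubmodule (Fin (n + 1)) k) (MvPolynomial.X i) →+* R) :
    ∃ (κ : k →+* R) (a : Fin (n + 1) → R) (hu : IsUnit ((MvPolynomial.X i).eval₂ κ a)),
      ψ = evA κ a (MvPolynomial.X i) hu ∧ a i = 1 := by
  let κ0 : k →+* Away (MvPolynomial.homogeneousSubmodule (Fin (n + 1)) k) (MvPolynomial.X i) :=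
    (fromZeroRingHom _ _).comp (algebraMap k (MvPolynomial.homogeneousSubmodule (Fin (n + 1)) k 0))
  let a0 : Fin (n + 1) → Away (MvPolynomial.homogeneousSubmodule (Fin (n + 1)) k) (MvPolynomial.X i) :=
    fun j => Away.mk _ (X_deg i) 1 (MvPolynomial.X j) (by rw [one_smul]; exact X_deg j)
  let L := Localization.Away (MvPolynomial.X i : MvPolynomial (Fin (n + 1)) k)
  have hA : ∀ z : Away (MvPolynomial.homogeneousSubmodule (Fin (n + 1)) k) (MvPolynomial.X i),
      algebraMap _ L z = z.val := fun z => HomogeneousLocalization.algebraMap_apply _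
  have h0 : ∀ e F hF, Away.mk _ (X_deg (k := k) i) e F hF = F.eval₂ κ0 a0 := by
    intro e F hF
    apply HomogeneousLocalization.val_injective
    rw [← hA (F.eval₂ κ0 a0), MvPolynomial.hom_eval₂, Away.val_mk]
    let u : L := Localization.mk 1 (⟨MvPolynomial.X i, by exact ⟨1, pow_one _⟩⟩ : Submonoid.powers (MvPolynomial.X i))
    have h1 : ((algebraMap _ L).comp κ0) = (algebraMap (MvPolynomial (Fin (n + 1)) k) L).comp MvPolynomial.C := by
      ext z
      rw [RingHom.comp_apply, hA]
      simp [κ0, fromZeroRingHom]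
      rfl
    have h2 : (fun j => algebraMap _ L (a0 j)) = fun j => u * (algebraMap (MvPolynomial (Fin (n + 1)) k) L (MvPolynomial.X j)) := by
      funext j
      rw [hA]
      simp only [a0, Away.val_mk, u]
      rw [← Localization.mk_one_eq_algebraMap, Localization.mk_mul]
      simp
    rw [h1, h2, eval₂_smul_homog _ _ _ hF, ← MvPolynomial.hom_eval₂]
    rw [← Localization.mk_one_eq_algebraMap, show u = Localization.mk 1 _ from rfl,
      Localization.mk_pow, Localization.mk_mul]
    simp only [MvPolynomial.eval₂_eta, one_pow, one_mul, mul_one, smul_eq_mul]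
    rfl
  have hai : a0 i = 1 := by
    apply HomogeneousLocalization.val_injective
    rw [Away.val_mk, HomogeneousLocalization.val_one]
    convert Localization.mk_self _ using 2
    simp
  have hu : (MvPolynomial.X i).eval₂ (ψ.comp κ0) (ψ ∘ a0) = 1 := by
    rw [MvPolynomial.eval₂_X, Function.comp_apply, hai, map_one]
  refine ⟨ψ.comp κ0, ψ ∘ a0, by rw [hu]; exact isUnit_one, ?_, by simp [hai]⟩
  refine evA_ext _ _ _ _ (X_deg i) _ fun e F hF => ?_
  rw [hu, one_pow, mul_one, h0, MvPolynomial.hom_eval₂]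
  rfl

theorem Rep.exists_local {T : Scheme.{0}} (f : T ⟶ ProjSpace k n) (x : T) :
    ∃ (R : CommRingCat.{0}) (g : Spec R ⟶ T) (κ : k →+* R) (a : Fin (n + 1) → R),
      IsOpenImmersion g ∧ x ∈ Set.range g ∧ Rep κ a (g ≫ f) := by
  have hcov : ⨆ i : Fin (n + 1), Proj.basicOpen (MvPolynomial.homogeneousSubmodule (Fin (n + 1)) k)
      (MvPolynomial.X i) = ⊤ := by
    apply Proj.iSup_basicOpen_eq_top' _ _ (fun i => ⟨1, X_deg i⟩)
    rw [eq_top_iff]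
    intro z _
    have : z ∈ Algebra.adjoin k (Set.range (MvPolynomial.X : Fin (n + 1) → MvPolynomial (Fin (n + 1)) k)) := by
      rw [MvPolynomial.adjoin_range_X]; trivial
    induction this using Algebra.adjoin_induction with
    | mem x hx => exact Algebra.subset_adjoin hx
    | algebraMap r => 
      exact Subalgebra.algebraMap_mem _ (algebraMap k (MvPolynomial.homogeneousSubmodule (Fin (n + 1)) k 0) r)
    | add x y _ _ hx hy => exact add_mem (hx trivial) (hy trivial)
    | mul x y _ _ hx hy => exact mul_mem (hx trivial) (hy trivial)
  obtain ⟨i, hi⟩ := Opens.mem_iSup.mp (hcov.ge (show f x ∈ (⊤ : Opens _) from trivial))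
  obtain ⟨U, hU, hxU, hUV⟩ := exists_isAffineOpen_mem_and_subset (X := T) (x := x)
    (U := f ⁻¹ᵁ Proj.basicOpen (MvPolynomial.homogeneousSubmodule (Fin (n + 1)) k) (MvPolynomial.X i)) hi
  let ι := Proj.awayι (MvPolynomial.homogeneousSubmodule (Fin (n + 1)) k) (MvPolynomial.X i) (X_deg i) one_pos
  have hr : Set.range (hU.fromSpec ≫ f) ⊆ Set.range ι := by
    have h1 : Set.range ι = (Proj.basicOpen (MvPolynomial.homogeneousSubmodule (Fin (n + 1)) k) (MvPolynomial.X i) : Set _) :=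
      congrArg (fun U : (ProjSpace k n).Opens => (U : Set (ProjSpace k n))) (Proj.opensRange_awayι _ _ (X_deg i) one_pos)
    rw [h1]
    rintro _ ⟨y, rfl⟩
    rw [Scheme.Hom.comp_apply]
    refine hUV ?_
    exact hU.range_fromSpec.le ⟨y, rfl⟩
  obtain ⟨κ, a, hu, h, -⟩ := evA_surj i (Spec.preimage (IsOpenImmersion.lift ι (hU.fromSpec ≫ f) hr)).hom
  refine ⟨_, hU.fromSpec, κ, a, inferInstance, by rw [hU.range_fromSpec]; exact hxU, i, hu, ?_⟩
  rw [ptf, ← h, CommRingCat.ofHom_hom, Spec.map_preimage]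
  exact (IsOpenImmersion.lift_fac _ _ _).symm

theorem Rep.rel {R : CommRingCat.{0}} {κ κ' : k →+* R} {a a' : Fin (n + 1) → R}
    {f : Spec R ⟶ ProjSpace k n} (hf : Rep κ a f) (hf' : Rep κ' a' f) :
    κ = κ' ∧ ∃ u, IsUnit u ∧ ∀ i, a' i = u * a i := by
  have hκ : κ = κ' := by
    have := Spec.map_injective (hf.structMap.symm.trans hf'.structMap)
    exact congrArg CommRingCat.Hom.hom this
  refine ⟨hκ, ?_⟩
  subst hκ
  obtain ⟨i, hi, h⟩ := hf
  obtain ⟨j, hj, h'⟩ := hf'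
  set 𝒜 := MvPolynomial.homogeneousSubmodule (Fin (n + 1)) k
  have e := h.symm.trans h'
  rw [ptf, ptf] at e
  let ψ := Spec.preimage (pullback.lift _ _ e ≫ (Proj.pullbackAwayιIso 𝒜 (X_deg i) one_pos (X_deg j) one_pos rfl).hom)
  have e1 : CommRingCat.ofHom (awayMap 𝒜 (X_deg j) rfl) ≫ ψ = CommRingCat.ofHom (evA κ a _ hi) := by
    apply Spec.map_injective
    rw [Spec.map_comp, Spec.map_preimage, Category.assoc, Proj.pullbackAwayιIso_hom_SpecMap_awayMap_left,
      pullback.lift_fst]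
  have e2 : CommRingCat.ofHom (awayMap 𝒜 (X_deg i) (mul_comm _ _)) ≫ ψ = CommRingCat.ofHom (evA κ a' _ hj) := by
    apply Spec.map_injective
    rw [Spec.map_comp, Spec.map_preimage, Category.assoc]
    rw [Proj.pullbackAwayιIso_hom_SpecMap_awayMap_right, pullback.lift_snd]
  have hx2 : MvPolynomial.X i * MvPolynomial.X j ∈ 𝒜 2 := SetLike.mul_mem_graded (X_deg (k := k) i) (X_deg j)
  let m : Fin (n + 1) → Fin (n + 1) → Away 𝒜 (MvPolynomial.X i * MvPolynomial.X j) := fun s t =>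
    Away.mk 𝒜 hx2 1 (MvPolynomial.X s * MvPolynomial.X t) (by 
      rw [one_smul]; exact SetLike.mul_mem_graded (X_deg (k := k) s) (X_deg t))
  have hm : ∀ s t s' t', m s t * m s' t' = m s s' * m t t' := by
    intro s t s' t'
    apply HomogeneousLocalization.val_injective
    simp only [HomogeneousLocalization.val_mul, m, Away.val_mk, Localization.mk_mul]
    congr 1
    ring
  have hm1 : m i j = 1 := by
    apply HomogeneousLocalization.val_injective
    rw [Away.val_mk, HomogeneousLocalization.val_one]
    convert Localization.mk_self _ using 2
    simp
  have ha : ∀ s, ψ.hom (m s j) * a i = a s := by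
    intro s
    have h1 := evA_mk κ a _ hi (X_deg i) 1 (MvPolynomial.X s) (by rw [one_smul]; exact X_deg s)
    rw [← CommRingCat.hom_ofHom (evA κ a _ hi), ← e1, CommRingCat.hom_comp, RingHom.comp_apply,
      CommRingCat.hom_ofHom, awayMap_mk, MvPolynomial.eval₂_X, MvPolynomial.eval₂_X] at h1
    refine Eq.trans ?_ h1
    rw [pow_one (M := R)]
    congr 2
    apply HomogeneousLocalization.val_injective
    rw [Away.val_mk, Away.val_mk]
    congr 1
    rw [pow_one]
  have ha' : ∀ s, ψ.hom (m s i) * a' j = a' s := by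
    intro s
    have h1 := evA_mk κ a' _ hj (X_deg j) 1 (MvPolynomial.X s) (by rw [one_smul]; exact X_deg s)
    rw [← CommRingCat.hom_ofHom (evA κ a' _ hj), ← e2, CommRingCat.hom_comp, RingHom.comp_apply,
      CommRingCat.hom_ofHom, awayMap_mk, MvPolynomial.eval₂_X, MvPolynomial.eval₂_X] at h1
    refine Eq.trans ?_ h1
    rw [pow_one (M := R)]
    congr 2
    apply HomogeneousLocalization.val_injective
    rw [Away.val_mk, Away.val_mk]
    congr 1
    rw [pow_one]
  rw [MvPolynomial.eval₂_X] at hi hj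
  obtain ⟨b, hb⟩ := hi
  have hinv : ψ.hom (m i i) * ψ.hom (m j j) = 1 := by
    rw [← map_mul, hm, hm1, mul_one, map_one]
  have hbb : a i * (↑b⁻¹ : R) = 1 := by rw [← hb]; simp
  refine ⟨ψ.hom (m i i) * a' j * ↑b⁻¹, ((IsUnit.of_mul_eq_one _ hinv).mul hj).mul (Units.isUnit _), fun s => ?_⟩
  rw [← ha s, ← ha' s]
  have : m i i * m s j = m s i := by
    rw [hm, hm1, mul_one]
    simp only [m]
    congr 1
    exact mul_comm _ _
  rw [← this, map_mul]
  linear_combination (-ψ.hom (m i i) * a' j * ψ.hom (m s j)) * hbb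

end Segre

section Segre
open HomogeneousLocalization

variable {k : Type} [CommRing k] {n m N : ℕ}

theorem hom_ext_affine {T Z : Scheme.{0}} (f g : T ⟶ Z)
    (h : ∀ (R : CommRingCat.{0}) (u : Spec R ⟶ T), IsOpenImmersion u → u ≫ f = u ≫ g) : f = g := by
  refine Scheme.Cover.hom_ext T.affineCover f g fun i => ?_
  exact h _ _ (T.affineCover.map_prop i)

theorem exists_map_eq {R S : CommRingCat.{0}} (f : Spec R ⟶ Spec S) : ∃ φ : S ⟶ R, f = Spec.map φ :=
  ⟨Spec.preimage f, (Spec.map_preimage f).symm⟩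

/-- coordinates of the Segre embedding -/
def seg (e : Fin (N + 1) ≃ Fin (n + 1) × Fin (m + 1)) {R : Type} [CommRing R] (a : Fin (n + 1) → R)
    (b : Fin (m + 1) → R) : Fin (N + 1) → R := fun s => a (e s).1 * b (e s).2

theorem seg_compat (e : Fin (N + 1) ≃ Fin (n + 1) × Fin (m + 1)) {R : CommRingCat.{0}}
    {κ κ' : k →+* R} {a a' : Fin (n + 1) → R} {b b' : Fin (m + 1) → R}
    {f : Spec R ⟶ ProjSpace k n} {f' : Spec R ⟶ ProjSpace k m} {h h' : Spec R ⟶ ProjSpace k N}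
    (h1 : Rep κ a f) (h2 : Rep κ b f') (h3 : Rep κ' a' f) (h4 : Rep κ' b' f')
    (h5 : Rep κ (seg e a b) h) (h6 : Rep κ' (seg e a' b') h') : h = h' := by
  obtain ⟨rfl, u, hu, hua⟩ := h1.rel h3
  obtain ⟨_, v, hv, hvb⟩ := h2.rel h4
  have : seg e a' b' = fun i => (u * v) * seg e a b i := by
    funext i
    simp only [seg, hua, hvb]; ring
  rw [this] at h6
  exact (h5.smul (hu.mul hv)).unique h6

theorem exists_seg (e : Fin (N + 1) ≃ Fin (n + 1) × Fin (m + 1)) {R : CommRingCat.{0}}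
    {κ : k →+* R} {a : Fin (n + 1) → R} {b : Fin (m + 1) → R}
    {f : Spec R ⟶ ProjSpace k n} {f' : Spec R ⟶ ProjSpace k m}
    (h1 : Rep κ a f) (h2 : Rep κ b f') : ∃ h : Spec R ⟶ ProjSpace k N, Rep κ (seg e a b) h := by
  obtain ⟨i, hi⟩ := h1.isUnit
  obtain ⟨j, hj⟩ := h2.isUnit
  refine Rep.exists_of_isUnit (e.symm (i, j)) ?_
  simpa [seg] using hi.mul hj

theorem Rep.kappa {R : CommRingCat.{0}} {κ κ' : k →+* R} {a : Fin (n + 1) → R} {b : Fin (m + 1) → R}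
    {f : Spec R ⟶ ProjSpace k n} {f' : Spec R ⟶ ProjSpace k m} (h1 : Rep κ a f) (h2 : Rep κ' b f')
    (h : f ≫ ProjSpace.structMap k n = f' ≫ ProjSpace.structMap k m) : κ = κ' := by
  rw [h1.structMap, h2.structMap] at h
  exact congrArg CommRingCat.Hom.hom (Spec.map_injective h)

/-- local coordinates for a pair of maps -/
theorem exists_local_pair {T : Scheme.{0}} (f : T ⟶ ProjSpace k n) (f' : T ⟶ ProjSpace k m)
    (h : f ≫ ProjSpace.structMap k n = f' ≫ ProjSpace.structMap k m) (x : T) :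
    ∃ (R : CommRingCat.{0}) (g : Spec R ⟶ T) (κ : k →+* R) (a : Fin (n + 1) → R) (b : Fin (m + 1) → R),
      IsOpenImmersion g ∧ x ∈ Set.range g ∧ Rep κ a (g ≫ f) ∧ Rep κ b (g ≫ f') := by
  obtain ⟨R, g, κ, a, hg, ⟨y, rfl⟩, h1⟩ := Rep.exists_local f x
  obtain ⟨S, g', κ', b, hg', ⟨z, rfl⟩, h2⟩ := Rep.exists_local (g ≫ f') y
  obtain ⟨φ, rfl⟩ := exists_map_eq g'
  have h1' := h1.map φ
  have := Rep.kappa h1' h2 (by simp [h])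
  subst this
  refine ⟨S, Spec.map φ ≫ g, _, _, b, inferInstance, ⟨z, by simp⟩, by simpa using h1', by simpa using h2⟩

theorem exists_segre (e : Fin (N + 1) ≃ Fin (n + 1) × Fin (m + 1)) {T : Scheme.{0}}
    (f : T ⟶ ProjSpace k n) (f' : T ⟶ ProjSpace k m)
    (hff : f ≫ ProjSpace.structMap k n = f' ≫ ProjSpace.structMap k m) :
    ∃ s : T ⟶ ProjSpace k N, ∀ (R : CommRingCat.{0}) (g : Spec R ⟶ T) (κ : k →+* R) (a : Fin (n + 1) → R)
      (b : Fin (m + 1) → R), Rep κ a (g ≫ f) → Rep κ b (g ≫ f') → Rep κ (seg e a b) (g ≫ s) := by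
  choose R g κ a b hg hx h1 h2 using exists_local_pair f f' hff
  choose s hs using fun x => exists_seg e (h1 x) (h2 x)
  have key : ∀ (x : T) (S : CommRingCat.{0}) (g' : Spec S ⟶ T) (κ' : k →+* S) (a' : Fin (n + 1) → S)
      (b' : Fin (m + 1) → S) (h' : Spec S ⟶ ProjSpace k N), Rep κ' a' (g' ≫ f) → Rep κ' b' (g' ≫ f') →
      Rep κ' (seg e a' b') h' → pullback.fst g' (g x) ≫ h' = pullback.snd g' (g x) ≫ s x := by
    intro x S g' κ' a' b' h' q1 q2 q3
    refine hom_ext_affine _ _ fun Q u _ => ?_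
    obtain ⟨φ, hφ⟩ := exists_map_eq (u ≫ pullback.fst g' (g x))
    obtain ⟨ψ, hψ⟩ := exists_map_eq (u ≫ pullback.snd g' (g x))
    have hc : Spec.map φ ≫ g' = Spec.map ψ ≫ g x := by
      rw [← hφ, ← hψ, Category.assoc, Category.assoc, pullback.condition]
    rw [← Category.assoc, ← Category.assoc, hφ, hψ]
    have r1 := q1.map φ
    have r2 := q2.map φ
    have r3 := q3.map φ
    have r4 := (h1 x).map ψ
    have r5 := (h2 x).map ψ
    have r6 := (hs x).map ψ
    rw [← Category.assoc, hc, Category.assoc] at r1 r2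
    refine seg_compat e r1 r2 r4 r5 ?_ ?_
    · convert r3 using 1
      funext i; simp [seg]
    · convert r6 using 1
      funext i; simp [seg]
  let 𝒰 : T.OpenCover := 
    { I₀ := T
      X := fun x => Spec (R x)
      f := g
      mem₀ := by
        rw [Scheme.ofArrows_mem_precoverage_iff]
        exact ⟨fun x => ⟨x, hx x⟩, hg⟩ }
  refine ⟨𝒰.glueMorphisms s fun x y => key y _ (g x) _ _ _ (s x) (h1 x) (h2 x) (hs x), ?_⟩
  intro S g' κ' a' b' q1 q2
  obtain ⟨h', q3⟩ := exists_seg e q1 q2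
  convert q3
  refine Scheme.Cover.hom_ext (𝒰.pullback₁ g') _ _ fun x => ?_
  have := key x S g' κ' a' b' h' q1 q2 q3
  change pullback.fst g' (g x) ≫ _ = pullback.fst g' (g x) ≫ _
  rw [this, ← Category.assoc, pullback.condition, Category.assoc]
  congr 1
  exact Scheme.Cover.ι_glueMorphisms 𝒰 s _ x

theorem seg_inj (e : Fin (N + 1) ≃ Fin (n + 1) × Fin (m + 1)) {R : CommRingCat.{0}}
    {κ κ' : k →+* R} {a a' : Fin (n + 1) → R} {b b' : Fin (m + 1) → R}
    {f g : Spec R ⟶ ProjSpace k n} {f' g' : Spec R ⟶ ProjSpace k m} {h : Spec R ⟶ ProjSpace k N}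
    (h1 : Rep κ a f) (h2 : Rep κ b f') (h3 : Rep κ' a' g) (h4 : Rep κ' b' g')
    (h5 : Rep κ (seg e a b) h) (h6 : Rep κ' (seg e a' b') h) : f = g ∧ f' = g' := by
  obtain ⟨rfl, u, hu, hh⟩ := h5.rel h6
  have hh' : ∀ i j, a' i * b' j = u * (a i * b j) := by
    intro i j
    have := hh (e.symm (i, j))
    simpa [seg] using this
  obtain ⟨i, hi⟩ := h3.isUnit
  obtain ⟨j, hj⟩ := h4.isUnit
  have hij : IsUnit (u * (a i * b j)) := by rw [← hh']; exact hi.mul hj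
  have hai : IsUnit (a i) := isUnit_of_mul_isUnit_left (isUnit_of_mul_isUnit_right hij)
  have hbj : IsUnit (b j) := isUnit_of_mul_isUnit_right (isUnit_of_mul_isUnit_right hij)
  constructor
  · have : (fun s => b' j * a' s) = fun s => (u * b j) * a s := by
      funext s; rw [mul_comm, hh']; ring
    have q := h3.smul hj
    rw [this] at q
    exact (h1.smul (hu.mul hbj)).unique q
  · have : (fun s => a' i * b' s) = fun s => (u * a i) * b s := by
      funext s; rw [hh']; ring
    have q := h4.smul hi
    rw [this] at q
    exact (h2.smul (hu.mul hai)).unique q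

theorem segre_mono (e : Fin (N + 1) ≃ Fin (n + 1) × Fin (m + 1)) 
    (s : pullback (ProjSpace.structMap k n) (ProjSpace.structMap k m) ⟶ ProjSpace k N)
    (hs : ∀ (R : CommRingCat.{0}) (g : Spec R ⟶ pullback (ProjSpace.structMap k n) (ProjSpace.structMap k m))
      (κ : k →+* R) (a : Fin (n + 1) → R)
      (b : Fin (m + 1) → R), Rep κ a (g ≫ pullback.fst _ _) → Rep κ b (g ≫ pullback.snd _ _) →
        Rep κ (seg e a b) (g ≫ s)) : Mono s := by
  constructor
  intro T f g hfg
  have hloc : ∀ x : T, ∃ (R : CommRingCat.{0}) (u : Spec R ⟶ T), IsOpenImmersion u ∧ x ∈ Set.range u ∧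
      u ≫ f = u ≫ g := by
    intro x
    obtain ⟨R, u, κ, a, b, hu, ⟨y, rfl⟩, h1, h2⟩ := exists_local_pair (f ≫ pullback.fst _ _) (f ≫ pullback.snd _ _)
      (by simp [pullback.condition]) x
    obtain ⟨S, v, κ', a', b', hv, ⟨z, rfl⟩, h3, h4⟩ := exists_local_pair ((u ≫ g) ≫ pullback.fst _ _)
      ((u ≫ g) ≫ pullback.snd _ _) (by simp [pullback.condition]) y
    obtain ⟨φ, rfl⟩ := exists_map_eq v
    refine ⟨S, Spec.map φ ≫ u, inferInstance, ⟨z, by simp⟩, ?_⟩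
    have r1 := h1.map φ
    have r2 := h2.map φ
    have q1 := hs S (Spec.map φ ≫ u ≫ f) _ _ _ (by simpa using r1) (by simpa using r2)
    have q2 := hs S (Spec.map φ ≫ u ≫ g) _ _ _ (by simpa using h3) (by simpa using h4)
    have : (Spec.map φ ≫ u ≫ f) ≫ s = (Spec.map φ ≫ u ≫ g) ≫ s := by simp [hfg]
    rw [this] at q1
    have := seg_inj e r1 r2 h3 h4 q1 q2
    apply pullback.hom_ext
    · simpa using this.1
    · simpa using this.2
  choose R u hu hx he using hloc
  let 𝒰 : T.OpenCover := 
    { I₀ := T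
      X := fun x => Spec (R x)
      f := u
      mem₀ := by
        rw [Scheme.ofArrows_mem_precoverage_iff]
        exact ⟨fun x => ⟨x, hx x⟩, hu⟩ }
  exact Scheme.Cover.hom_ext 𝒰 f g he

instance structMap_proper : IsProper (ProjSpace.structMap k n) := by
  have : Algebra.FiniteType (MvPolynomial.homogeneousSubmodule (Fin (n + 1)) k 0) (MvPolynomial (Fin (n + 1)) k) := by
    have : IsScalarTower k (MvPolynomial.homogeneousSubmodule (Fin (n + 1)) k 0) (MvPolynomial (Fin (n + 1)) k) :=
      ⟨fun x y z => by
        change (x • (y : MvPolynomial (Fin (n + 1)) k)) * z = x • ((y : MvPolynomial (Fin (n + 1)) k) * z)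
        exact smul_mul_assoc _ _ _⟩
    exact Algebra.FiniteType.of_restrictScalars_finiteType k _ _
  have : Function.Bijective (algebraMap k (MvPolynomial.homogeneousSubmodule (Fin (n + 1)) k 0)) := by
    constructor
    · intro x y hxy
      exact MvPolynomial.C_injective (Fin (n + 1)) k (congrArg Subtype.val hxy)
    · intro F
      have : F.1.totalDegree = 0 := Nat.le_zero.mp (MvPolynomial.IsHomogeneous.totalDegree_le F.2)
      exact ⟨_, Subtype.ext (MvPolynomial.totalDegree_eq_zero_iff_eq_C.mp this).symm⟩
  have : IsIso (CommRingCat.ofHom (algebraMap k (MvPolynomial.homogeneousSubmodule (Fin (n + 1)) k 0))) := by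
    rw [ConcreteCategory.isIso_iff_bijective]; exact this
  unfold ProjSpace.structMap
  infer_instance

theorem segre (n m : ℕ) : ∃ (N : ℕ)
    (s : pullback (ProjSpace.structMap k n) (ProjSpace.structMap k m) ⟶ ProjSpace k N),
    IsClosedImmersion s ∧ s ≫ ProjSpace.structMap k N = pullback.fst _ _ ≫ ProjSpace.structMap k n := by
  obtain ⟨N, hN⟩ : ∃ N, (n + 1) * (m + 1) = N + 1 := ⟨(n + 1) * (m + 1) - 1, by
    have : 0 < (n + 1) * (m + 1) := by positivity
    omega⟩
  have e : Fin (N + 1) ≃ Fin (n + 1) × Fin (m + 1) := (finProdFinEquiv.trans (finCongr hN)).symm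
  obtain ⟨s, hs⟩ := exists_segre e (pullback.fst (ProjSpace.structMap k n) (ProjSpace.structMap k m))
    (pullback.snd _ _) pullback.condition
  have hm := segre_mono e s hs
  have hstr : s ≫ ProjSpace.structMap k N = pullback.fst _ _ ≫ ProjSpace.structMap k n := by
    choose R g κ a b hg hx h1 h2 using exists_local_pair (pullback.fst (ProjSpace.structMap k n) (ProjSpace.structMap k m)) 
      (pullback.snd _ _) pullback.condition
    let 𝒰 : Scheme.OpenCover (pullback (ProjSpace.structMap k n) (ProjSpace.structMap k m)) := 
      { I₀ := _
        X := fun x => Spec (R x)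
        f := g
        mem₀ := by
          rw [Scheme.ofArrows_mem_precoverage_iff]
          exact ⟨fun x => ⟨x, hx x⟩, hg⟩ }
    refine Scheme.Cover.hom_ext 𝒰 _ _ fun x => ?_
    have := (hs _ _ _ _ _ (h1 x) (h2 x)).structMap
    have h3 := (h1 x).structMap
    rw [Category.assoc] at this h3
    exact this.trans h3.symm
  refine ⟨N, s, ?_, hstr⟩
  rw [IsClosedImmersion.iff_isProper_and_mono]
  refine ⟨?_, hm⟩
  have : IsProper (s ≫ ProjSpace.structMap k N) := by rw [hstr]; infer_instance
  exact IsProper.of_comp s (ProjSpace.structMap k N)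

end Segre

section Segre
open HomogeneousLocalization

theorem irreducibleSpace_of_cover {X : Type*} [TopologicalSpace X] {ι : Type*} [Nonempty ι] (U : ι → Set X)
    (hU : ∀ i, IsOpen (U i)) (hi : ∀ i, IsIrreducible (U i)) (hc : ⋃ i, U i = Set.univ)
    (hij : ∀ i j, (U i ∩ U j).Nonempty) : IrreducibleSpace X := by
  rw [irreducibleSpace_def]
  refine ⟨⟨(hi (Classical.arbitrary ι)).1.some, trivial⟩, ?_⟩
  intro A B hA hB ⟨x, _, hx⟩ ⟨y, _, hy⟩
  obtain ⟨i, hxi⟩ := Set.mem_iUnion.mp (hc.ge (Set.mem_univ x))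
  obtain ⟨j, hyj⟩ := Set.mem_iUnion.mp (hc.ge (Set.mem_univ y))
  obtain ⟨z, hzi, hzA, hzj⟩ := (hi i).2 A (U j) hA (hU j) ⟨x, hxi, hx⟩ (hij i j)
  obtain ⟨w, hwj, hwA, hwB⟩ := (hi j).2 A B hA hB ⟨z, hzj, hzA⟩ ⟨y, hyj, hy⟩
  exact ⟨w, trivial, hwA, hwB⟩

theorem geomIrr_of_retract {Z A S : Scheme.{0}} (i : Z ⟶ A) (r : A ⟶ Z) (z : Z ⟶ S) (h : i ≫ r = 𝟙 _)
    [hA : GeometricallyIrreducible (r ≫ z)] : GeometricallyIrreducible z := by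
  refine ⟨geometrically_iff_of_isClosedUnderIsomorphisms.mpr fun K _ y ↦ ?_⟩
  have hirr : IrreducibleSpace ↥(pullback (r ≫ z) y) :=
    geometrically_iff_of_isClosedUnderIsomorphisms.mp hA.1 K y
  let p : pullback (r ≫ z) y ⟶ pullback z y := pullback.map _ _ _ _ r (𝟙 _) (𝟙 _) (by simp) (by simp)
  let s : pullback z y ⟶ pullback (r ≫ z) y := pullback.map _ _ _ _ i (𝟙 _) (𝟙 _)
    (by rw [← Category.assoc, h]; simp) (by simp)
  have hsp : s ≫ p = 𝟙 _ := by
    apply pullback.hom_ext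
    · have h1 : s ≫ p ≫ pullback.fst _ _ = pullback.fst _ _ ≫ i ≫ r := by
        rw [pullback.lift_fst, ← Category.assoc, pullback.lift_fst, Category.assoc]
      rw [Category.assoc, h1, h]; simp
    · have h1 : s ≫ p ≫ pullback.snd _ _ = pullback.snd _ _ := by
        rw [pullback.lift_snd, Category.comp_id, pullback.lift_snd, Category.comp_id]
      rw [Category.assoc, h1]; simp
  have hsurj : Function.Surjective p := fun x => ⟨s x, by
    rw [← Scheme.Hom.comp_apply, hsp]; rfl⟩
  exact Function.Surjective.irreducibleSpace p.continuous hsurj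

variable {k : Type} [Field k] {n : ℕ}

theorem chart_geomIrr (i : Fin (n + 1)) : GeometricallyIrreducible
    (Proj.awayι (MvPolynomial.homogeneousSubmodule (Fin (n + 1)) k) (MvPolynomial.X i) (X_deg i) one_pos ≫
      ProjSpace.structMap k n) := by
  obtain ⟨κ0, a0, hu0, h0, ha0⟩ := evA_surj (k := k) i (RingHom.id _)
  let a1 : Fin (n + 1) → MvPolynomial (Fin (n + 1)) k := fun j => if j = i then 1 else MvPolynomial.X j
  have hu1 : IsUnit ((MvPolynomial.X i).eval₂ MvPolynomial.C a1) := by simp [a1]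
  let p := evA MvPolynomial.C a1 (MvPolynomial.X i) hu1
  let q : MvPolynomial (Fin (n + 1)) k →+* _ := MvPolynomial.eval₂Hom κ0 a0
  have hqp : q.comp p = RingHom.id _ := by
    rw [h0]
    refine evA_ext _ _ _ _ (X_deg i) _ fun e F hF => ?_
    have := congrArg q (evA_mk MvPolynomial.C a1 _ hu1 (X_deg i) e F hF)
    rw [map_mul, map_pow, MvPolynomial.hom_eval₂, MvPolynomial.hom_eval₂] at this
    have h1 : (q.comp MvPolynomial.C) = κ0 := by ext; simp [q]
    have h2 : (fun j => q (a1 j)) = a0 := by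
      funext j
      by_cases hj : j = i
      · subst hj; simp [a1, ha0]
      · simp [a1, hj, q]
    rw [h1, h2] at this
    exact this
  have hrep := Rep.structMap (R := CommRingCat.of (MvPolynomial (Fin (n + 1)) k)) (κ := MvPolynomial.C)
    (a := a1) ⟨i, hu1, rfl⟩
  rw [ptf, Category.assoc] at hrep
  have hG : GeometricallyIrreducible (Spec.map (CommRingCat.ofHom (MvPolynomial.C (R := k) (σ := Fin (n + 1))))) := by
    rw [← AffineSpace.SpecIso_inv_over (n := Fin (n + 1)) (CommRingCat.of k)]
    infer_instance
  refine @geomIrr_of_retract _ _ _ (Spec.map (CommRingCat.ofHom q)) (Spec.map (CommRingCat.ofHom p)) _ ?_ ?_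
  · rw [← Spec.map_comp, ← CommRingCat.ofHom_comp, hqp]
    simp
  · rw [hrep]; exact hG

instance structMap_flat : Flat (ProjSpace.structMap k n) := inferInstance

instance structMap_lofp : LocallyOfFinitePresentation (ProjSpace.structMap k n) :=
  LocallyOfFinitePresentation.iff_locallyOfFiniteType.mpr inferInstance

theorem cov_basicOpen {k : Type} [CommRing k] {n : ℕ} : ⨆ i : Fin (n + 1), Proj.basicOpen (MvPolynomial.homogeneousSubmodule (Fin (n + 1)) k)
      (MvPolynomial.X i) = ⊤ := by
    apply Proj.iSup_basicOpen_eq_top' _ _ (fun i => ⟨1, X_deg i⟩)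
    rw [eq_top_iff]
    intro z _
    have : z ∈ Algebra.adjoin k (Set.range (MvPolynomial.X : Fin (n + 1) → MvPolynomial (Fin (n + 1)) k)) := by
      rw [MvPolynomial.adjoin_range_X]; trivial
    induction this using Algebra.adjoin_induction with
    | mem x hx => exact Algebra.subset_adjoin hx
    | algebraMap r => 
      exact Subalgebra.algebraMap_mem _ (algebraMap k (MvPolynomial.homogeneousSubmodule (Fin (n + 1)) k 0) r)
    | add x y _ _ hx hy => exact add_mem (hx trivial) (hy trivial)
    | mul x y _ _ hx hy => exact mul_mem (hx trivial) (hy trivial)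

instance structMap_geomIrr : GeometricallyIrreducible (ProjSpace.structMap k n) := by
  refine ⟨geometrically_iff_of_isClosedUnderIsomorphisms.mpr fun L _ y ↦ ?_⟩
  let ι := fun i : Fin (n + 1) => 
    Proj.awayι (MvPolynomial.homogeneousSubmodule (Fin (n + 1)) k) (MvPolynomial.X i) (X_deg i) one_pos
  let c := fun i : Fin (n + 1) => pullback.map (ι i ≫ ProjSpace.structMap k n) y (ProjSpace.structMap k n) y
    (ι i) (𝟙 _) (𝟙 _) (by simp) (by simp)
  have hirr : ∀ i, IrreducibleSpace ↥(pullback (ι i ≫ ProjSpace.structMap k n) y) := fun i =>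
    geometrically_iff_of_isClosedUnderIsomorphisms.mp (chart_geomIrr i).1 L y
  have hpb : ∀ i, IsPullback (pullback.fst (ι i ≫ ProjSpace.structMap k n) y) (c i) (ι i)
      (pullback.fst (ProjSpace.structMap k n) y) := by
    intro i
    refine (IsPullback.of_right (h₁₂ := pullback.snd _ _) (h₂₂ := ProjSpace.structMap k n) (v₁₃ := y) ?_ ?_ (IsPullback.of_hasPullback _ _).flip).flip
    · have : c i ≫ pullback.snd _ _ = pullback.snd _ _ := by
        rw [pullback.lift_snd, Category.comp_id]
      rw [this]
      exact (IsPullback.of_hasPullback _ _).flip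
    · exact pullback.lift_fst _ _ _
  have hr : ∀ i, Set.range (c i) = pullback.fst (ProjSpace.structMap k n) y ⁻¹' Set.range (ι i) := by
    intro i
    have := Scheme.image_preimage_eq_of_isPullback (hpb i) Set.univ
    rw [Set.preimage_univ, Set.image_univ, Set.image_univ] at this
    exact this
  have h1 : ∀ i, Set.range (ι i) = (Proj.basicOpen (MvPolynomial.homogeneousSubmodule (Fin (n + 1)) k) (MvPolynomial.X i) : Set _) := fun i =>
    congrArg (fun U : (ProjSpace k n).Opens => (U : Set (ProjSpace k n))) (Proj.opensRange_awayι _ _ (X_deg i) one_pos)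
  refine irreducibleSpace_of_cover (fun i => Set.range (c i)) (fun i => ?_) (fun i => ?_) ?_ ?_
  · rw [hr, h1]
    exact (Proj.basicOpen _ _).2.preimage (pullback.fst (ProjSpace.structMap k n) y).continuous
  · rw [← Set.image_univ]
    exact (IrreducibleSpace.isIrreducible_univ _).image _ (c i).continuous.continuousOn
  · rw [Set.eq_univ_iff_forall]
    intro x
    obtain ⟨i, hi⟩ := Opens.mem_iSup.mp ((cov_basicOpen (k := k) (n := n)).ge
      (show pullback.fst (ProjSpace.structMap k n) y x ∈ (⊤ : Opens _) from trivial))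
    refine Set.mem_iUnion.mpr ⟨i, ?_⟩
    rw [hr, h1]; exact hi
  · intro i j
    have hu : ∀ i : Fin (n + 1), IsUnit ((MvPolynomial.X i).eval₂ (RingHom.id k) (fun _ : Fin (n + 1) => (1 : CommRingCat.of k))) := by
      intro i; simp
    let x0 : SpecOf k := (inferInstance : Nonempty (SpecOf k)).some
    let f := fun i : Fin (n + 1) => ptf (R := CommRingCat.of k) (RingHom.id k) (fun _ => 1) (MvPolynomial.X i) (X_deg i) one_pos (hu i)
    have hf : f i = f j := ptf_indep _ _ _ _ _ _ _ _ _ _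
    have hm : ∀ i, f i x0 ∈ Set.range (ι i) := fun i => ⟨_, (Scheme.Hom.comp_apply _ _ _).symm⟩
    let y0 : Spec (CommRingCat.of L) := (inferInstance : Nonempty (Spec (CommRingCat.of L))).some
    obtain ⟨z, hz, -⟩ := Scheme.Pullback.exists_preimage_pullback (f := ProjSpace.structMap k n) (g := y) (f i x0) y0
      (Subsingleton.elim (α := PrimeSpectrum k) _ _)
    refine ⟨z, ?_, ?_⟩
    · rw [hr]; rw [Set.mem_preimage]; rw [hz]; exact hm i
    · rw [hr]; rw [Set.mem_preimage]; rw [hz, hf]; exact hm j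
end Segre

/-- Product of `W` with a finite family of projective spaces, with its universal property. -/
theorem exists_product {k : Type} [Field k] (n : ℕ) (ι : Type) [Finite ι] {W : Scheme.{0}} (w : W ⟶ SpecOf k) [IrreducibleSpace W]
    (hW : ∃ (N : ℕ) (s : W ⟶ ProjSpace k N), IsClosedImmersion s ∧ s ≫ ProjSpace.structMap k N = w) :
    ∃ (X : Scheme.{0}) (p0 : X ⟶ W) (p : ι → (X ⟶ ProjSpace k n)),
      (∀ i, p i ≫ ProjSpace.structMap k n = p0 ≫ w) ∧
      (∀ (T : Scheme.{0}) (t : T ⟶ W) (f : ι → (T ⟶ ProjSpace k n)), (∀ i, f i ≫ ProjSpace.structMap k n = t ≫ w) →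
        ∃ g : T ⟶ X, g ≫ p0 = t ∧ ∀ i, g ≫ p i = f i) ∧
      (∀ (T : Scheme.{0}) (g g' : T ⟶ X), g ≫ p0 = g' ≫ p0 → (∀ i, g ≫ p i = g' ≫ p i) → g = g') ∧
      IrreducibleSpace X ∧
      (∃ (N : ℕ) (s : X ⟶ ProjSpace k N), IsClosedImmersion s ∧ s ≫ ProjSpace.structMap k N = p0 ≫ w) := by
  induction ι using Finite.induction_empty_option with
  | of_equiv e ih =>
    obtain ⟨X, p0, p, h1, h2, h3, h4, h5⟩ := ih
    refine ⟨X, p0, fun i => p (e.symm i), fun i => h1 _, ?_, ?_, h4, h5⟩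
    · intro T t f hf
      obtain ⟨g, hg, hg'⟩ := h2 T t (fun i => f (e i)) (fun i => hf _)
      exact ⟨g, hg, fun i => by simpa using hg' (e.symm i)⟩
    · intro T g g' h0 h
      exact h3 T g g' h0 fun i => by simpa using h (e i)
  | h_empty =>
    refine ⟨W, 𝟙 W, fun i => i.elim, fun i => i.elim, ?_, ?_, inferInstance, ?_⟩
    · intro T t f hf
      exact ⟨t, by simp, fun i => i.elim⟩
    · intro T g g' h0 h
      simpa using h0
    · simpa using hW
  | h_option ih =>
    obtain ⟨X, p0, p, h1, h2, h3, h4, N, s, hs, hs'⟩ := ih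
    refine ⟨pullback (p0 ≫ w) (ProjSpace.structMap k n), pullback.fst _ _ ≫ p0,
      fun i => i.elim (pullback.snd _ _) (fun i => pullback.fst _ _ ≫ p i), ?_, ?_, ?_, ?_, ?_⟩
    · rintro (_ | i)
      · simp [pullback.condition]
      · simp [h1]
    · intro T t f hf
      obtain ⟨g, hg, hg'⟩ := h2 T t (fun i => f (some i)) (fun i => hf _)
      refine ⟨pullback.lift g (f none) (by rw [← Category.assoc, hg, hf]), ?_, ?_⟩
      · rw [← Category.assoc, pullback.lift_fst, hg]
      · rintro (_ | i)
        · exact pullback.lift_snd _ _ _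
        · show _ ≫ _ ≫ _ = _
          rw [← Category.assoc, pullback.lift_fst, hg']
    · intro T g g' h0 h
      apply pullback.hom_ext
      · apply h3
        · simpa using h0
        · intro i; simpa using h (some i)
      · simpa using h none
    · infer_instance
    · obtain ⟨M, r, hr, hr'⟩ := segre (k := k) N n
      let q : pullback (p0 ≫ w) (ProjSpace.structMap k n) ⟶ pullback (ProjSpace.structMap k N) (ProjSpace.structMap k n) :=
        pullback.map _ _ _ _ s (𝟙 _) (𝟙 _) (by simp [hs']) (by simp)
      have hq : IsClosedImmersion q := by
        have hc : IsPullback q (pullback.fst _ _) (pullback.fst (ProjSpace.structMap k N) (ProjSpace.structMap k n)) s := by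
          refine (IsPullback.of_right (h₁₂ := pullback.snd _ _) (h₂₂ := ProjSpace.structMap k N) (v₁₃ := ProjSpace.structMap k n) ?_ ?_ (IsPullback.of_hasPullback _ _).flip)
          · have : q ≫ pullback.snd _ _ = pullback.snd _ _ := by
              rw [pullback.lift_snd, Category.comp_id]
            rw [this, hs']
            exact (IsPullback.of_hasPullback _ _).flip
          · exact pullback.lift_fst _ _ _
        exact MorphismProperty.of_isPullback hc.flip hs
      refine ⟨M, q ≫ r, inferInstance, ?_⟩
      rw [Category.assoc, hr']
      have : q ≫ pullback.fst _ _ = pullback.fst _ _ ≫ s := pullback.lift_fst _ _ _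
      rw [← Category.assoc, this, Category.assoc, hs', Category.assoc]

theorem isDomain_of_principal {A : Type} [CommRing A] [IsLocalRing A] [IsNoetherianRing A] (t : A)
    (ht : IsLocalRing.maximalIdeal A = Ideal.span {t}) (hreg : ∀ x, t * x = 0 → x = 0) :
    IsDomain A ∧ IsPrincipalIdealRing A := by
  have key : ∀ x : A, x ≠ 0 → ∃ n u, IsUnit u ∧ x = t ^ n * u := by
    intro x hx
    have hinf : ∃ n, x ∉ IsLocalRing.maximalIdeal A ^ n := by
      by_contra hcon
      push Not at hcon
      have : x ∈ (⨅ i, IsLocalRing.maximalIdeal A ^ i : Ideal A) := by simpa using hcon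
      rw [Ideal.iInf_pow_eq_bot_of_isLocalRing _ (IsLocalRing.maximalIdeal.isMaximal A).ne_top] at this
      exact hx (by simpa using this)
    classical
    obtain ⟨n, hn, hmin⟩ : ∃ n, x ∉ IsLocalRing.maximalIdeal A ^ n ∧ ∀ m < n, x ∈ IsLocalRing.maximalIdeal A ^ m :=
      ⟨Nat.find hinf, Nat.find_spec hinf, fun m hm => not_not.mp (Nat.find_min hinf hm)⟩
    obtain _ | n := n
    · simp at hn
    have h1 := hmin n (Nat.lt_succ_self n)
    rw [ht, Ideal.span_singleton_pow, Ideal.mem_span_singleton] at h1 hn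
    obtain ⟨u, rfl⟩ := h1
    refine ⟨n, u, ?_, rfl⟩
    by_contra hu
    have : u ∈ IsLocalRing.maximalIdeal A := hu
    rw [ht, Ideal.mem_span_singleton] at this
    obtain ⟨w, rfl⟩ := this
    exact hn ⟨w, by ring⟩
  have hpow : ∀ n x, t ^ n * x = 0 → x = 0 := by
    intro n
    induction n with
    | zero => simp
    | succ n ih => intro x hx; exact ih _ (hreg _ (by rw [← hx]; ring))
  have hdom : IsDomain A := by
    have : NoZeroDivisors A := by
      refine ⟨fun {x y} hxy => ?_⟩
      by_contra! hcon
      obtain ⟨n, u, hu, rfl⟩ := key x hcon.1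
      obtain ⟨m, v, hv, rfl⟩ := key y hcon.2
      have h2 := hpow (n + m) (u * v) (by rw [← hxy]; ring)
      exact not_isUnit_zero (h2 ▸ hu.mul hv)
    exact NoZeroDivisors.to_isDomain A
  refine ⟨hdom, ?_⟩
  exact ((tfae_of_isNoetherianRing_of_isLocalRing_of_isDomain A).out 0 4 rfl rfl).mpr ⟨⟨t, ht⟩⟩

theorem stalk_of_etale {k : Type} [Field k] (n : ℕ) (hn : n ≤ 1) {S : Type} [CommRing S] [Algebra (MvPolynomial (Fin n) k) S]
    [Algebra.Etale (MvPolynomial (Fin n) k) S] (q : Ideal S) [q.IsPrime] :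
    IsDomain (Localization.AtPrime q) ∧ IsPrincipalIdealRing (Localization.AtPrime q) := by
  have hS : IsNoetherianRing S := Algebra.FiniteType.isNoetherianRing (MvPolynomial (Fin n) k) S
  have hN : IsNoetherianRing (Localization.AtPrime q) := IsLocalization.isNoetherianRing q.primeCompl _ hS
  set R := MvPolynomial (Fin n) k
  have hpir : IsPrincipalIdealRing R := by
    obtain rfl | rfl : n = 0 ∨ n = 1 := by omega
    · exact IsPrincipalIdealRing.of_surjective (MvPolynomial.isEmptyAlgEquiv k (Fin 0)).symm.toRingHom
        (MvPolynomial.isEmptyAlgEquiv k (Fin 0)).symm.surjective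
    · exact IsPrincipalIdealRing.of_surjective (MvPolynomial.uniqueAlgEquiv k (Fin 1)).symm.toRingHom
        (MvPolynomial.uniqueAlgEquiv k (Fin 1)).symm.surjective
  let _ : Algebra (Localization.AtPrime (q.under R)) (Localization.AtPrime q) := Localization.AtPrime.algebraOfLiesOver (q.under R) q
  have hmap : (q.under R).map (algebraMap R (Localization.AtPrime q)) = IsLocalRing.maximalIdeal _ :=
    ((Algebra.isUnramifiedAt_iff_map_eq R (q.under R) q).mp inferInstance).2
  obtain ⟨t, ht⟩ := (hpir.principal (q.under R)).principal
  rw [Ideal.submodule_span_eq] at ht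
  rw [ht, Ideal.map_span, Set.image_singleton] at hmap
  by_cases h0 : t = 0
  · have : IsField (Localization.AtPrime q) := by
      rw [IsLocalRing.isField_iff_maximalIdeal_eq, ← hmap, h0]; simp
    letI := this.toField
    exact ⟨inferInstance, inferInstance⟩
  · refine isDomain_of_principal _ hmap.symm ?_
    have hfl : Module.Flat R (Localization.AtPrime q) := Module.Flat.trans R S _
    intro x hx
    have h1 : IsSMulRegular (Localization.AtPrime q) t := 
      Module.Flat.isSMulRegular_of_nonZeroDivisors (mem_nonZeroDivisors_of_ne_zero h0)
    apply h1
    simpa [Algebra.smul_def] using hx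

theorem exists_affine_etale {k : Type} [Field k] {X : Scheme.{0}} (f : X ⟶ SpecOf k) [Smooth f] (x : X) :
    ∃ (A : CommRingCat.{0}) (g : Spec A ⟶ X) (n : ℕ) (a : MvPolynomial (Fin n) k →+* A), IsOpenImmersion g ∧
      x ∈ Set.range g ∧ g ≫ f = Spec.map (CommRingCat.ofHom (a.comp MvPolynomial.C)) ∧ a.Etale := by
  obtain ⟨A, g, a, hg, ⟨y, rfl⟩, h, -⟩ := exists_affine_specMap f x
  have hs : Smooth (Spec.map a) := by rw [← h]; infer_instance
  rw [HasRingHomProperty.Spec_iff (P := @Smooth), RingHom.smooth_iff_locally_isStandardSmooth] at hs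
  obtain ⟨s, hs, hloc⟩ := hs
  obtain ⟨t, hts, hty⟩ : ∃ t ∈ s, t ∉ y.asIdeal := by
    by_contra! hcon
    have : Ideal.span s ≤ y.asIdeal := Ideal.span_le.mpr hcon
    rw [hs] at this
    exact y.isPrime.ne_top (top_le_iff.mp this)
  obtain ⟨n, b, hb, hbe⟩ := (hloc t hts).exists_etale_mvPolynomial
  let l : A ⟶ CommRingCat.of (Localization.Away t) := CommRingCat.ofHom (algebraMap A _)
  have hl : IsOpenImmersion (Spec.map l) := inferInstance
  refine ⟨CommRingCat.of (Localization.Away t), Spec.map l ≫ g, n, b, inferInstance, ?_, ?_, hbe⟩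
  · have : y ∈ Set.range (Spec.map l) := by
      have := PrimeSpectrum.localization_away_comap_range (Localization.Away t) t
      exact this.ge hty
    obtain ⟨z, hz⟩ := this
    exact ⟨z, by rw [Scheme.Hom.comp_apply, hz]⟩
  · rw [Category.assoc, h, ← Spec.map_comp, hb]
    rfl

theorem stalk_pid {k : Type} [Field k] {X : Scheme.{0}} (f : X ⟶ SpecOf k) [Smooth f]
    (hdim : ∀ x : X, Order.height x ≤ 1) (x : X) :
    IsDomain (X.presheaf.stalk x) ∧ IsPrincipalIdealRing (X.presheaf.stalk x) := by
  obtain ⟨A, g, n, a, hg, ⟨y, rfl⟩, h, hae⟩ := exists_affine_etale f x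
  algebraize [a]
  have hn : n ≤ 1 := by
    have hgen := RingHom.Flat.generalizingMap_comap (f := a) (show Module.Flat _ _ from inferInstance)
    obtain ⟨q, hqy, hq⟩ := hgen (show (⟨⊥, Ideal.isPrime_bot⟩ : PrimeSpectrum (MvPolynomial (Fin n) k)) ⤳ PrimeSpectrum.comap a y from 
      (PrimeSpectrum.le_iff_specializes _ _).mp bot_le)
    have hq' : Ideal.comap a q.asIdeal = ⊥ := congrArg PrimeSpectrum.asIdeal hq
    have := q.isPrime
    let c : MvPolynomial (Fin n) k →+* A ⧸ q.asIdeal := (Ideal.Quotient.mk q.asIdeal).comp a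
    have hc : Function.Injective c := by
      rw [RingHom.injective_iff_ker_eq_bot, RingHom.ker, ← Ideal.comap_comap, ← RingHom.ker,
        Ideal.mk_ker, hq']
    let _ : Algebra k (A ⧸ q.asIdeal) := (c.comp MvPolynomial.C).toAlgebra
    have hft : Algebra.FiniteType k (A ⧸ q.asIdeal) := by
      have h0 : (algebraMap k (A ⧸ q.asIdeal)).FiniteType := by
        have h1 : a.FiniteType := show Algebra.FiniteType _ _ from inferInstance
        have h2 : (MvPolynomial.C (R := k) (σ := Fin n)).FiniteType :=
          RingHom.finiteType_algebraMap.mpr (inferInstance : Algebra.FiniteType k (MvPolynomial (Fin n) k))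
        exact ((RingHom.FiniteType.of_surjective _ Ideal.Quotient.mk_surjective).comp h1).comp h2
      exact h0
    obtain ⟨s, hs, hs'⟩ := dim_trdeg k (A ⧸ q.asIdeal)
    have h1 := spec_height_eq A q
    have h2 : Order.height (α := Spec A) q ≤ 1 := (height_le_of_isOpenImmersion g q).trans (hdim _)
    rw [hs] at h1
    let c' : MvPolynomial (Fin n) k →ₐ[k] A ⧸ q.asIdeal := ⟨c, fun r => rfl⟩
    have h3 := trdeg_le_of_injective c' hc
    rw [hs', MvPolynomial.trdeg_of_isDomain] at h3
    have h4 : n ≤ s := by simpa using h3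
    have h5 : Order.height (α := Spec A) q = (s : ℕ∞) := by exact_mod_cast h1
    rw [h5] at h2
    have h6 : s ≤ 1 := by exact_mod_cast h2
    omega
  have hyp : y.asIdeal.IsPrime := y.isPrime
  have := stalk_of_etale (k := k) n hn (S := A) y.asIdeal
  let e1 : X.presheaf.stalk (g y) ≃+* (Spec A).presheaf.stalk y := (asIso (g.stalkMap y)).commRingCatIsoToRingEquiv
  let e2 : (Spec A).presheaf.stalk y ≃+* Localization.AtPrime y.asIdeal := (Spec.stalkIso A y).commRingCatIsoToRingEquiv
  let e := e1.trans e2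
  have h1 := this.1
  have h2 := this.2
  exact ⟨e.toMulEquiv.isDomain _, IsPrincipalIdealRing.of_surjective e.symm.toRingHom e.symm.surjective⟩

theorem exists_gen {X : Scheme.{0}} (x : X) [IsDomain (X.presheaf.stalk x)] : ∃ v : X, ∀ y, y ⤳ x → v ⤳ y := by
  refine ⟨X.fromSpecStalk x (⟨⊥, Ideal.isPrime_bot⟩ : PrimeSpectrum (X.presheaf.stalk x)), fun y hy => ?_⟩
  have : y ∈ Set.range (X.fromSpecStalk x) := by rw [Scheme.range_fromSpecStalk]; exact hy
  obtain ⟨z, rfl⟩ := this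
  refine Specializes.map ?_ (X.fromSpecStalk x).continuous
  exact (PrimeSpectrum.le_iff_specializes _ _).mp bot_le

theorem irreducible_of_domain_stalks {k : Type} [Field k] {X : Scheme.{0}} (f : X ⟶ SpecOf k) [LocallyOfFiniteType f]
    [QuasiCompact f] [ConnectedSpace X] (h : ∀ x : X, IsDomain (X.presheaf.stalk x)) : IrreducibleSpace X := by
  have hfin := finite_maximal f
  obtain ⟨v, -, -, hv⟩ := exists_maximal_ge (Classical.arbitrary X)
  have hdisj : ∀ v w x : X, (∀ w, v ≤ w → w = v) → (∀ u, w ≤ u → u = w) → v ⤳ x → w ⤳ x → v = w := by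
    intro v w x hv hw h1 h2
    have := h x
    obtain ⟨g, hg⟩ := exists_gen x
    rw [← hv g (hg v h1), ← hw g (hg w h2)]
  have hcl : IsClopen (closure {v}) := by
    refine ⟨isClosed_closure, ?_⟩
    rw [← isClosed_compl_iff]
    have : (closure {v})ᶜ = ⋃ w ∈ {w : X | ∀ u, w ≤ u → u = w} \ {v}, closure {w} := by
      ext x
      simp only [Set.mem_compl_iff, Set.mem_iUnion, exists_prop]
      constructor
      · intro hx
        obtain ⟨w, hxw, -, hw⟩ := exists_maximal_ge x
        refine ⟨w, ⟨hw, ?_⟩, specializes_iff_mem_closure.mp hxw⟩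
        rintro rfl
        exact hx (specializes_iff_mem_closure.mp hxw)
      · rintro ⟨w, ⟨hw, hne⟩, hx⟩ hx'
        exact hne (hdisj _ _ x hw hv (specializes_iff_mem_closure.mpr hx) (specializes_iff_mem_closure.mpr hx'))
    rw [this]
    exact (hfin.subset Set.diff_subset).isClosed_biUnion fun _ _ => isClosed_closure
  have huniv : closure {v} = Set.univ := by
    rcases isClopen_iff.mp hcl with h0 | h0
    · exact absurd h0 (Set.nonempty_iff_ne_empty.mp ⟨v, subset_closure rfl⟩)
    · exact h0
  rw [irreducibleSpace_def, Set.top_eq_univ, ← huniv]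
  exact isIrreducible_singleton.closure

/-- Reduced induced closed subscheme structure. -/
theorem exists_reduced_closed {X : Scheme.{0}} (C : Set X) (hC : IsClosed C) :
    ∃ (Z : Scheme.{0}) (s : Z ⟶ X), IsClosedImmersion s ∧ IsReduced Z ∧ Set.range s = C := by
  let I := Scheme.IdealSheafData.vanishingIdeal (X := X) ⟨C, hC⟩
  refine ⟨I.subscheme, I.subschemeι, inferInstance, ?_, ?_⟩
  · apply +allowSynthFailures @IsReduced.of_openCover (𝒰 := I.subschemeCover.openCover)
    intro U
    have : _root_.IsReduced (Γ(X, U.1) ⧸ I.ideal U) := by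
      rw [← Ideal.isRadical_iff_quotient_reduced]
      exact PrimeSpectrum.isRadical_vanishingIdeal _
    exact inferInstanceAs (IsReduced (Spec (.of (Γ(X, U.1) ⧸ I.ideal U))))
  · rw [Scheme.IdealSheafData.range_subschemeι]
    rfl

theorem exists_lift_closed {X Z T : Scheme.{0}} (s : Z ⟶ X) [IsClosedImmersion s] (f : T ⟶ X)
    [IsReduced T] (h : Set.range f ⊆ Set.range s) : ∃ g : T ⟶ Z, g ≫ s = f := by
  have : Surjective (pullback.fst f s) := by
    constructor
    intro t
    obtain ⟨z, hz⟩ := h ⟨t, rfl⟩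
    obtain ⟨w, hw, _⟩ := Scheme.Pullback.exists_preimage_pullback (f := f) (g := s) t z hz.symm
    exact ⟨w, hw⟩
  have := isIso_of_isClosedImmersion_of_surjective (pullback.fst f s)
  refine ⟨inv (pullback.fst f s) ≫ pullback.snd f s, ?_⟩
  rw [Category.assoc, ← pullback.condition, IsIso.inv_hom_id_assoc]

theorem flat_maximal {X Y : Scheme.{0}} (f : X ⟶ Y) (hf : SchemeFlat f) (v : X)
    (hv : ∀ w, w ⤳ v → w = v) (y : Y) (hy : y ⤳ f v) : y = f v := by
  have hy' : y ∈ Set.range (Y.fromSpecStalk (f v)) := by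
    rw [Scheme.range_fromSpecStalk]; exact hy
  obtain ⟨q, rfl⟩ := hy'
  have hsurj : Function.Surjective (Spec.map (f.stalkMap v)) := by
    algebraize [(f.stalkMap v).hom]
    have : Module.FaithfullyFlat (Y.presheaf.stalk (f v)) (X.presheaf.stalk v) :=
      @Module.FaithfullyFlat.of_flat_of_isLocalHom _ _ _ _ _ _ _
        (hf v) (f.toLRSHom.prop v)
    exact PrimeSpectrum.comap_surjective_of_faithfullyFlat
  obtain ⟨p, rfl⟩ := hsurj q
  have h1 : X.fromSpecStalk v p = v := by
    apply hv
    have : X.fromSpecStalk v p ∈ Set.range (X.fromSpecStalk v) := ⟨p, rfl⟩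
    rw [Scheme.range_fromSpecStalk] at this
    exact this
  rw [← Scheme.Hom.comp_apply, Scheme.SpecMap_stalkMap_fromSpecStalk, Scheme.Hom.comp_apply, h1]

/-- prime ideals of the stalk = generalizations; minimal primes are maximal points -/
theorem minimalPrime_maximal {X : Scheme.{0}} (x : X) (p : Spec (X.presheaf.stalk x))
    (hp : p.asIdeal ∈ minimalPrimes (X.presheaf.stalk x)) (w : X)
    (hw : w ⤳ X.fromSpecStalk x p) : w = X.fromSpecStalk x p := by
  have h1 : X.fromSpecStalk x p ⤳ x := by
    have : X.fromSpecStalk x p ∈ Set.range (X.fromSpecStalk x) := ⟨p, rfl⟩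
    rw [Scheme.range_fromSpecStalk] at this
    exact this
  have h2 : w ∈ Set.range (X.fromSpecStalk x) := by
    rw [Scheme.range_fromSpecStalk]
    exact hw.trans h1
  obtain ⟨q, rfl⟩ := h2
  have h3 : q ⤳ p := (X.fromSpecStalk x).isEmbedding.specializes_iff.mp hw
  have h4 : q.asIdeal ≤ p.asIdeal := (PrimeSpectrum.le_iff_specializes q p).mpr h3
  have h5 := hp.2 ⟨q.isPrime, bot_le⟩ h4
  have : q = p := PrimeSpectrum.ext (le_antisymm h4 h5)
  rw [this]

theorem comap_minimal_eq_bot {X W : Scheme.{0}} (f : X ⟶ W) (η : W) (hη : ∀ w, η ⤳ w)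
    (hX : ∀ v : X, (∀ w, w ⤳ v → w = v) → f v = η) (x : X) [IsDomain (W.presheaf.stalk (f x))]
    (p : Ideal (X.presheaf.stalk x)) (hp : p ∈ minimalPrimes (X.presheaf.stalk x)) :
    p.comap (f.stalkMap x).hom = ⊥ := by
  have := hp.1.1
  let p' : Spec (X.presheaf.stalk x) := ⟨p, hp.1.1⟩
  have h1 : f (X.fromSpecStalk x p') = η := hX _ (fun w hw => minimalPrime_maximal x p' hp w hw)
  have h2 : W.fromSpecStalk (f x) (Spec.map (f.stalkMap x) p') = η := by
    rw [← Scheme.Hom.comp_apply, Scheme.SpecMap_stalkMap_fromSpecStalk, Scheme.Hom.comp_apply, h1]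
  let b : Spec (W.presheaf.stalk (f x)) := ⟨⊥, Ideal.isPrime_bot⟩
  have h3 : W.fromSpecStalk (f x) (Spec.map (f.stalkMap x) p') ⤳ W.fromSpecStalk (f x) b := by
    rw [h2]; exact hη _
  have h4 := (W.fromSpecStalk (f x)).isEmbedding.specializes_iff.mp h3
  exact le_bot_iff.mp ((PrimeSpectrum.le_iff_specializes _ _).mpr h4)

theorem schemeFlat_of_reduced {X W : Scheme.{0}} [IsReduced X] (f : X ⟶ W) (η : W)
    (hη : ∀ w, η ⤳ w) (hX : ∀ v : X, (∀ w, w ⤳ v → w = v) → f v = η)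
    (hW : ∀ w : W, IsDomain (W.presheaf.stalk w) ∧ IsPrincipalIdealRing (W.presheaf.stalk w)) :
    SchemeFlat f := by
  intro x
  obtain ⟨i1, i2⟩ := hW (f x)
  algebraize [(f.stalkMap x).hom]
  change Module.Flat _ _
  rw [Module.Flat.flat_iff_torsion_eq_bot_of_isBezout, eq_bot_iff]
  rintro s ⟨⟨r, hr⟩, hrs⟩
  have hr0 : r ≠ 0 := nonZeroDivisors.ne_zero hr
  have hrs' : (f.stalkMap x).hom r * s = 0 := by
    have := hrs
    rw [Submonoid.mk_smul, Algebra.smul_def] at this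
    exact this
  have key : s ∈ sInf (minimalPrimes (X.presheaf.stalk x) : Set (Ideal _)) := by
    rw [Submodule.mem_sInf]
    intro p hp
    have := hp.1.1
    have h0 : (f.stalkMap x).hom r * s ∈ p := by rw [hrs']; exact p.zero_mem
    rcases this.mem_or_mem h0 with h | h
    · exfalso
      have h5 : r ∈ Ideal.comap (f.stalkMap x).hom p := h
      rw [comap_minimal_eq_bot f η hη hX x p hp] at h5
      exact hr0 h5
    · exact h
  rw [minimalPrimes, Ideal.sInf_minimalPrimes] at key
  have h6 : (⊥ : Ideal (X.presheaf.stalk x)).radical = ⊥ :=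
    Ideal.radical_eq_iff.mpr Ideal.isRadical_bot
  rw [h6] at key
  exact key

/-- The universal property of `(P^n)^G × W` yields an equivariant embedding. -/
theorem exists_equivariant {k : Type} [Field k] (n : ℕ) {G : Type} [Group G] {W : Scheme.{0}}
    (w : W ⟶ SpecOf k) {V X : Scheme.{0}} (p0 : X ⟶ W) (p : G → (X ⟶ ProjSpace k n))
    (hp : ∀ i, p i ≫ ProjSpace.structMap k n = p0 ≫ w)
    (hex : ∀ (T : Scheme.{0}) (t : T ⟶ W) (f : G → (T ⟶ ProjSpace k n)),
        (∀ i, f i ≫ ProjSpace.structMap k n = t ≫ w) →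
        ∃ g : T ⟶ X, g ≫ p0 = t ∧ ∀ i, g ≫ p i = f i)
    (hun : ∀ (T : Scheme.{0}) (g g' : T ⟶ X), g ≫ p0 = g' ≫ p0 →
      (∀ i, g ≫ p i = g' ≫ p i) → g = g')
    (i : V ⟶ ProjSpace k n) [IsImmersion i] (t : V ⟶ W)
    (hi : i ≫ ProjSpace.structMap k n = t ≫ w)
    (ρ : G →* Aut V) (hρ : ∀ g, (ρ g).hom ≫ t = t) :
    ∃ (m : V ⟶ X) (a : G →* Aut X), IsImmersion m ∧ m ≫ p0 = t ∧
      (∀ g, m ≫ (a g).hom = (ρ g).hom ≫ m) ∧ ∀ g, (a g).hom ≫ p0 = p0 := by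
  obtain ⟨m, hm0, hm⟩ := hex V t (fun h => (ρ h).hom ≫ i) (fun h => by
    rw [Category.assoc, hi, ← Category.assoc, hρ])
  have hb : ∀ g : G, ∃ b : X ⟶ X, b ≫ p0 = p0 ∧ ∀ h, b ≫ p h = p (h * g) :=
    fun g => hex X p0 (fun h => p (h * g)) (fun h => hp _)
  choose b hb0 hb using hb
  have hb1 : b 1 = 𝟙 X := hun _ _ _ (by rw [hb0, Category.id_comp])
    (fun h => by rw [hb, mul_one, Category.id_comp])
  have hbm : ∀ g g', b (g * g') = b g' ≫ b g := fun g g' => hun _ _ _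
    (by rw [hb0, Category.assoc, hb0, hb0])
    (fun h => by rw [hb, Category.assoc, hb, hb, mul_assoc])
  let a : G →* Aut X :=
    { toFun := fun g => ⟨b g, b g⁻¹, by rw [← hbm, inv_mul_cancel, hb1],
        by rw [← hbm, mul_inv_cancel, hb1]⟩
      map_one' := by ext1; exact hb1
      map_mul' := fun g g' => by ext1; exact hbm g g' }
  refine ⟨m, a, ?_, hm0, ?_, hb0⟩
  · have h1 : m ≫ p 1 = i := by rw [hm, map_one]; exact Category.id_comp _
    have : IsImmersion (m ≫ p 1) := by rw [h1]; infer_instance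
    exact IsImmersion.of_comp m (p 1)
  · intro g
    apply hun
    · change (m ≫ b g) ≫ p0 = _
      rw [Category.assoc, hb0, Category.assoc, hm0, hρ]
    · intro h
      change (m ≫ b g) ≫ p h = _
      rw [Category.assoc, hb, hm, Category.assoc, hm, map_mul]
      exact Category.assoc _ _ _

theorem isIso_residueFieldMap {X Y : Scheme.{0}} (f : X ⟶ Y) [IsPreimmersion f] (x : X) :
    IsIso (f.residueFieldMap x) := by
  have hs : Function.Surjective (f.stalkMap x).hom := SurjectiveOnStalks.surj_on_stalks (f := f) x
  have h1 : Function.Surjective (f.residueFieldMap x).hom := by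
    intro a
    obtain ⟨b, rfl⟩ := IsLocalRing.residue_surjective a
    obtain ⟨c, rfl⟩ := hs b
    exact ⟨IsLocalRing.residue _ c, rfl⟩
  have h2 : Function.Bijective (f.residueFieldMap x).hom := ⟨RingHom.injective _, h1⟩
  exact (RingEquiv.ofBijective _ h2).toCommRingCatIso.isIso_hom

theorem height_immersion {k : Type} [Field k] {X' X : Scheme.{0}} (g : X' ⟶ X) (f : X ⟶ SpecOf k)
    [IsPreimmersion g] [LocallyOfFiniteType f] [LocallyOfFiniteType (g ≫ f)] (x : X') :
    Order.height (g x) = Order.height x := by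
  have := isIso_residueFieldMap g x
  exact height_eq_of_residue g f x

/-- every point lies below a point of given larger height -/
theorem exists_ge_height {k : Type} [Field k] {X : Scheme.{0}} (f : X ⟶ SpecOf k)
    [LocallyOfFiniteType f] (x ξ : X) (hx : ξ ⤳ x) (d : ℕ) (h1 : Order.height x ≤ d)
    (h2 : d ≤ Order.height ξ) : ∃ y : X, y ⤳ x ∧ Order.height y = d := by
  letI := schemePO X
  choose h hh _ using height_dl f
  have hlt : ∀ a b : X, a < b → h a < h b := by
    intro a b hab
    have : Order.height a < Order.height b :=
      Order.height_strictMono hab (by rw [hh]; exact ENat.coe_lt_top _)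
    rw [hh, hh] at this
    exact_mod_cast this
  obtain ⟨y, hy1, -, hy3⟩ := between (P := X) h (fun a b hab => hlt a b hab) (by
    intro a b hab
    have := height_covBy f a b hab
    rw [hh, hh] at this
    exact_mod_cast this) d x ξ hx (by rw [hh] at h1; exact_mod_cast h1)
      (by rw [hh] at h2; exact_mod_cast h2)
  refine ⟨y, hy1, ?_⟩
  rw [hh, hy3]

/-- the closed set underlying the compactification -/
theorem exists_closed {k : Type} [Field k] {V X W : Scheme.{0}} (f : X ⟶ SpecOf k)
    [LocallyOfFiniteType f] [IrreducibleSpace X] (m : V ⟶ X) [IsPreimmersion m]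
    [LocallyOfFiniteType (m ≫ f)] [QuasiCompact (m ≫ f)] {G : Type} [Group G] [Finite G]
    (a : G →* Aut X) (p0 : X ⟶ W) (ha : ∀ g, (a g).hom ≫ p0 = p0) (η : W) (hη : ∀ w, η ⤳ w)
    (hm : ∀ v : V, (∀ w, w ⤳ v → w = v) → p0 (m v) = η)
    (d : ℕ) (hd : ∀ v : V, Order.height v ≤ d) (hd' : ∃ v : V, Order.height v = d) :
    ∃ (C : Set X), IsClosed C ∧ Set.range m ⊆ C ∧ (∀ g, ∀ x ∈ C, (a g).hom x ∈ C) ∧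
      ∀ x ∈ C, ∃ y ∈ C, y ⤳ x ∧ Order.height y = d ∧ p0 y = η := by
  have key : ∀ v : V, ∃ y : X, y ⤳ m v ∧ Order.height y = d := by
    intro v
    obtain ⟨v0, hv0⟩ := hd'
    have hξ : ∀ x : X, genericPoint X ⤳ x := fun x => genericPoint_specializes x
    refine exists_ge_height f (m v) (genericPoint X) (hξ _) d ?_ ?_
    · rw [height_immersion m f]; exact hd v
    · rw [← hv0, ← height_immersion m f]
      exact Order.height_mono (hξ _)
  choose y hy1 hy2 using key
  let M : Set V := {v : V | ∀ w, v ≤ w → w = v}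
  have hM : M.Finite := finite_maximal (m ≫ f)
  have hiso : ∀ g x, Order.height ((a g).hom x) = Order.height x := by
    intro g x
    have : IsIso (a g).hom := Iso.isIso_hom (a g)
    have hf : LocallyOfFiniteType ((a g).hom ≫ f) := inferInstance
    exact height_immersion (a g).hom f x
  refine ⟨⋃ g : G, ⋃ v ∈ M, closure {(a g).hom (y v)}, ?_, ?_, ?_, ?_⟩
  · exact isClosed_iUnion_of_finite fun g => hM.isClosed_biUnion fun v _ => isClosed_closure
  · rintro _ ⟨x, rfl⟩
    obtain ⟨v, h1, -, h2⟩ := exists_maximal_ge x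
    simp only [Set.mem_iUnion]
    refine ⟨1, v, h2, ?_⟩
    rw [← specializes_iff_mem_closure, map_one]
    exact (hy1 v).trans (Specializes.map h1 m.continuous)
  · intro g x hx
    simp only [Set.mem_iUnion] at hx ⊢
    obtain ⟨g', v, hv, h⟩ := hx
    refine ⟨g * g', v, hv, ?_⟩
    rw [← specializes_iff_mem_closure] at h ⊢
    have := h.map (a g).hom.continuous
    rw [← Scheme.Hom.comp_apply] at this
    rw [map_mul]
    exact this
  · intro x hx
    simp only [Set.mem_iUnion] at hx
    obtain ⟨g, v, hv, h⟩ := hx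
    refine ⟨(a g).hom (y v), ?_, specializes_iff_mem_closure.mpr h, ?_, ?_⟩
    · simp only [Set.mem_iUnion]
      exact ⟨g, v, hv, subset_closure rfl⟩
    · rw [hiso, hy2]
    · rw [← Scheme.Hom.comp_apply, ha]
      have h1 := (hy1 v).map p0.continuous
      rw [hm v hv] at h1
      exact (h1.antisymm (hη _)).eq

theorem dl_tower {k : Type} [Field k] {F W : Scheme.{0}} (w : W ⟶ SpecOf k) (y : W)
    (q : F ⟶ SpecOf (W.residueField y)) (x : F) :
    dl w y + dl q x =
      dl (q ≫ ((W.fromSpecResidueField y ≫ w : SpecOf (W.residueField y) ⟶ SpecOf k))) x := by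
  let a : CommRingCat.of k ⟶ W.residueField y := Spec.preimage (W.fromSpecResidueField y ≫ w)
  let b : W.residueField y ⟶ F.residueField x := Spec.preimage (F.fromSpecResidueField x ≫ q)
  have hab : Spec.preimage (F.fromSpecResidueField x ≫ (q ≫ (W.fromSpecResidueField y ≫ w :
      SpecOf (W.residueField y) ⟶ SpecOf k))) = a ≫ b := by
    apply Spec.map_injective
    rw [Spec.map_preimage, Spec.map_comp, Spec.map_preimage, Spec.map_preimage]
    exact (Category.assoc _ _ _).symm
  unfold dl
  rw [hab]
  letI : Algebra k (W.residueField y) := a.hom.toAlgebra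
  letI : Algebra (W.residueField y) (F.residueField x) := b.hom.toAlgebra
  letI : Algebra k (F.residueField x) := (a ≫ b).hom.toAlgebra
  have : IsScalarTower k (W.residueField y) (F.residueField x) :=
    IsScalarTower.of_algebraMap_eq (fun r => rfl)
  exact trdeg_add_eq k (W.residueField y) (A := F.residueField x)

/-- dimension formula for the fibres -/
theorem fiber_height {k : Type} [Field k] {X W : Scheme.{0}} (p : X ⟶ W) (w : W ⟶ SpecOf k)
    [LocallyOfFiniteType w] [LocallyOfFiniteType (p ≫ w)] (y : W) (x : p.fiber y) :
    Order.height y + Order.height x = Order.height (p.fiberι y x) := by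
  have : LocallyOfFiniteType p := locallyOfFiniteType_of_comp p w
  let q : p.fiber y ⟶ SpecOf (W.residueField y) := p.fiberToSpecResidueField y
  have hq' : LocallyOfFiniteType (pullback.snd p (W.fromSpecResidueField y)) := inferInstance
  have hq : LocallyOfFiniteType q := hq'
  obtain ⟨s1, h1, h1'⟩ := height_dl w y
  obtain ⟨s2, h2, h2'⟩ := height_dl q x
  obtain ⟨s3, h3, h3'⟩ := height_dl (p ≫ w) (p.fiberι y x)
  have := isIso_residueFieldMap (p.fiberι y) x
  have h4 := dl_tower w y q x
  have h5 : q ≫ (W.fromSpecResidueField y ≫ w : SpecOf (W.residueField y) ⟶ SpecOf k) =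
      p.fiberι y ≫ p ≫ w := by
    rw [← Category.assoc (p.fiberι y), Scheme.Hom.fiber_fac]
    exact (Category.assoc _ _ _).symm
  rw [h5, dl_comp, h1', h2', h3'] at h4
  rw [h1, h2, h3]
  exact_mod_cast h4

/-- Krull's principal ideal theorem: over a closed point of a curve -/
theorem covBy_of_maximal {X W : Scheme.{0}} [IsLocallyNoetherian X] (p : X ⟶ W) (x v : X)
    [IsPrincipalIdealRing (W.presheaf.stalk (p x))]
    (hx : ∀ z, z ⤳ x → p z = p x → z = x) (hv : v ⤳ x) (hpv : p v ≠ p x) : x ⋖ v := by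
  let R := W.presheaf.stalk (p x)
  let S := X.presheaf.stalk x
  let I : Ideal S := (IsLocalRing.maximalIdeal R).map (p.stalkMap x).hom
  have hI : I.IsPrincipal := by
    obtain ⟨π, hπ⟩ := (IsPrincipalIdealRing.principal (IsLocalRing.maximalIdeal R)).principal
    refine ⟨⟨(p.stalkMap x).hom π, ?_⟩⟩
    change (IsLocalRing.maximalIdeal R).map (p.stalkMap x).hom = _
    rw [hπ]
    exact (Ideal.map_span _ _).trans (by rw [Set.image_singleton])
  have hmin : IsLocalRing.maximalIdeal S ∈ I.minimalPrimes := by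
    refine ⟨⟨inferInstance, ?_⟩, ?_⟩
    · rw [Ideal.map_le_iff_le_comap]
      have : IsLocalHom (p.stalkMap x).hom := p.toLRSHom.prop x
      exact ((IsLocalRing.local_hom_TFAE (p.stalkMap x).hom).out 0 3).mp this
    · rintro J ⟨hJ, hIJ⟩ _
      let J' : Spec S := ⟨J, hJ⟩
      have h1 : Spec.map (p.stalkMap x) J' = IsLocalRing.closedPoint R := by
        apply PrimeSpectrum.ext
        have h2 : IsLocalRing.maximalIdeal R ≤ J.comap (p.stalkMap x).hom :=
          Ideal.map_le_iff_le_comap.mp hIJ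
        exact ((IsLocalRing.maximalIdeal.isMaximal R).eq_of_le
          (Ideal.IsPrime.ne_top (hJ.comap _)) h2).symm
      have h2 : p (X.fromSpecStalk x J') = p x := by
        rw [← Scheme.Hom.comp_apply, ← Scheme.SpecMap_stalkMap_fromSpecStalk,
          Scheme.Hom.comp_apply, h1, Scheme.fromSpecStalk_closedPoint]
      have h3 : X.fromSpecStalk x J' ⤳ x := by
        have : X.fromSpecStalk x J' ∈ Set.range (X.fromSpecStalk x) := ⟨J', rfl⟩
        rw [Scheme.range_fromSpecStalk] at this
        exact this
      have h4 : X.fromSpecStalk x J' = X.fromSpecStalk x (IsLocalRing.closedPoint S) := by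
        rw [hx _ h3 h2, Scheme.fromSpecStalk_closedPoint]
      have h5 := (X.fromSpecStalk x).isEmbedding.injective h4
      have h6 : J = IsLocalRing.maximalIdeal S := congrArg PrimeSpectrum.asIdeal h5
      exact h6.ge
  have hht : (IsLocalRing.maximalIdeal S).height ≤ 1 :=
    Ideal.height_le_one_of_isPrincipal_of_mem_minimalPrimes_of_isLocalRing I hmin
  refine ⟨lt_iff_le_not_ge.mpr ⟨hv, fun h => hpv ?_⟩, fun z hxz hzv => ?_⟩
  · have : v = x := (Specializes.antisymm hv h).eq
    rw [this]
  · have hlt : ∀ (a b : Spec S), X.fromSpecStalk x a < X.fromSpecStalk x b →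
        b.asIdeal < a.asIdeal := by
      intro a b hab
      rw [lt_iff_le_not_ge] at hab ⊢
      simp only [Scheme.le_iff_specializes, (X.fromSpecStalk x).isEmbedding.specializes_iff] at hab
      exact ⟨(PrimeSpectrum.le_iff_specializes _ _).mpr hab.1, fun h => hab.2
        ((PrimeSpectrum.le_iff_specializes _ _).mp h)⟩
    have hz' : z ∈ Set.range (X.fromSpecStalk x) := by
      rw [Scheme.range_fromSpecStalk]; exact hxz.le
    have hv' : v ∈ Set.range (X.fromSpecStalk x) := by
      rw [Scheme.range_fromSpecStalk]; exact hv
    obtain ⟨z, rfl⟩ := hz'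
    obtain ⟨v, rfl⟩ := hv'
    have h1 := hlt _ _ hzv
    have hxz' : X.fromSpecStalk x (IsLocalRing.closedPoint S) < X.fromSpecStalk x z := by
      rw [Scheme.fromSpecStalk_closedPoint]; exact hxz
    have h2 : z.asIdeal < IsLocalRing.maximalIdeal S := hlt _ _ hxz'
    have := z.isPrime
    have := v.isPrime
    have h3 := Ideal.height_add_one_le_of_lt_of_isPrime h1
    have h4 := Ideal.height_add_one_le_of_lt_of_isPrime h2
    have h5 : (1 : ℕ∞) + 1 ≤ 1 := by
      calc (1 : ℕ∞) + 1 ≤ (v.asIdeal.height + 1) + 1 := by gcongr; exact le_add_self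
        _ ≤ z.asIdeal.height + 1 := by gcongr
        _ ≤ _ := h4
        _ ≤ 1 := hht
    exact absurd h5 (by decide)

theorem height_homeo {α β : Type*} [TopologicalSpace α] [TopologicalSpace β] (φ : α ≃ₜ β) (x : α) :
    @Order.height β (specializationPreorder β) (φ x) =
      @Order.height α (specializationPreorder α) x := by
  letI := specializationPreorder α
  letI := specializationPreorder β
  let ψ : α ≃o β :=
    ⟨φ.toEquiv, fun {a b} => (φ.isEmbedding.specializes_iff : φ b ⤳ φ a ↔ b ⤳ a)⟩
  exact Order.height_orderIso ψ x

theorem isPure_fiber {k : Type} [Field k] {X W : Scheme.{0}} (p : X ⟶ W) (w : W ⟶ SpecOf k)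
    [LocallyOfFiniteType w] [LocallyOfFiniteType (p ≫ w)] (η : W) (hη : ∀ y, η ⤳ y)
    (hW : ∀ y : W, IsPrincipalIdealRing (W.presheaf.stalk y)) (d : ℕ)
    (hX : ∀ v : X, (∀ z, z ⤳ v → z = v) → p v = η ∧ Order.height v = d) (y : W) :
    IsPure (fiber p y) := by
  have : IsLocallyNoetherian X := LocallyOfFiniteType.isLocallyNoetherian (p ≫ w)
  -- heights of maximal points of the fibre
  obtain ⟨e, he⟩ : ∃ e : ℕ, ∀ x : X, p x = y → (∀ z, z ⤳ x → p z = y → z = x) →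
      Order.height x = e := by
    by_cases hy : y = η
    · refine ⟨d, fun x hx hmax => (hX x fun z hz => hmax z hz ?_).2⟩
      have h1 := hz.map p.continuous
      rw [hx, hy] at h1
      rw [hy]
      exact (h1.antisymm (hη _)).eq
    · refine ⟨d - 1, fun x hx hmax => ?_⟩
      obtain ⟨v, hv, -, hv'⟩ := exists_maximal_ge x
      obtain ⟨h1, h2⟩ := hX v hv'
      have := hW (p x)
      have hcov := covBy_of_maximal p x v (fun z hz hz' => hmax z hz (hz'.trans hx)) hv
        (by rw [h1, hx]; exact fun h => hy h.symm)
      have h3 := height_covBy (p ≫ w) v x hcov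
      obtain ⟨s, hs, -⟩ := height_dl (p ≫ w) x
      rw [h2, hs] at h3
      rw [hs]
      have : d = s + 1 := by exact_mod_cast h3
      rw [this]; rfl
  obtain ⟨r, hr, -⟩ := height_dl w y
  refine ⟨((e - r : ℕ) : WithBot ℕ∞), fun T hT => ?_⟩
  let φ : p.fiber y ≃ₜ fiber p y := p.fiberHomeo y
  have : QuasiSober (fiber p y) := φ.symm.isClosedEmbedding.quasiSober
  have : T0Space (fiber p y) := inferInstanceAs (T0Space (p ⁻¹' {y} : Set X))
  obtain ⟨x, hx1, hx2⟩ := component_height (fiber p y) T hT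
  rw [hx2]
  have h1 : @Order.height _ (specializationPreorder (fiber p y)) x = Order.height (φ.symm x) :=
    (congrArg _ (φ.apply_symm_apply x)).symm.trans (height_homeo φ (φ.symm x))
  rw [h1]
  have h3 := fiber_height p w y (φ.symm x)
  have h4 : p.fiberι y (φ.symm x) = x.1 := Scheme.Hom.fiberι_fiberHomeo_symm p y x
  rw [h4, he x.1 x.2 ?_, hr] at h3
  · have h5 : Order.height (φ.symm x) ≠ ⊤ := by
      intro h
      rw [h] at h3
      simp at h3
    obtain ⟨n, hn⟩ := ENat.ne_top_iff_exists.mp h5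
    rw [← hn] at h3 ⊢
    have : r + n = e := by exact_mod_cast h3
    have : n = e - r := by omega
    rw [this]; rfl
  · intro z hz hz'
    have := hx1 ⟨z, hz'⟩ (Topology.IsInducing.subtypeVal.specializes_iff.mp hz)
    exact congrArg Subtype.val this

theorem exists_action_lift {G : Type} [Group G] {Z X : Scheme.{0}} (s : Z ⟶ X) [IsClosedImmersion s]
    [IsReduced Z] (a : G →* Aut X) (h : ∀ g, ∀ x ∈ Set.range s, (a g).hom x ∈ Set.range s) :
    ∃ b : G →* Aut Z, ∀ g, (b g).hom ≫ s = s ≫ (a g).hom := by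
  have key : ∀ g, ∃ c : Z ⟶ Z, c ≫ s = s ≫ (a g).hom := fun g => by
    apply exists_lift_closed
    rintro _ ⟨z, rfl⟩
    rw [Scheme.Hom.comp_apply]
    exact h g _ ⟨z, rfl⟩
  choose c hc using key
  have h1 : c 1 = 𝟙 Z := by
    rw [← cancel_mono s, hc, map_one, Category.id_comp]
    exact Category.comp_id _
  have h2 : ∀ g g', c (g * g') = c g' ≫ c g := by
    intro g g'
    rw [← cancel_mono s, hc, Category.assoc, hc, ← Category.assoc, hc, map_mul]
    exact (Category.assoc _ _ _).symm
  exact ⟨{ toFun := fun g => ⟨c g, c g⁻¹, by rw [← h2, inv_mul_cancel, h1],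
            by rw [← h2, mul_inv_cancel, h1]⟩
           map_one' := by ext1; exact h1
           map_mul' := fun g g' => by ext1; exact h2 g g' }, hc⟩

theorem height_le_of_dim {k : Type} [Field k] {X : Scheme.{0}} (f : X ⟶ SpecOf k)
    [LocallyOfFiniteType f] [QuasiCompact f] [Nonempty X] (h : topologicalKrullDim X = 1) (x : X) :
    Order.height x ≤ 1 := by
  obtain ⟨d, h1, h2, -⟩ := exists_dim f
  rw [h] at h1
  have : d = 1 := by
    have h3 : (1 : WithBot ℕ∞) = (d : WithBot ℕ∞) := h1
    exact_mod_cast h3.symm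
  rw [this] at h2
  exact h2 x

/-- Equivariant flat compactification over the smooth projective model of a
smooth connected quasi-projective curve, with pure total space and pure fibres. -/
theorem statement1 (K : Type) [Field K] [IsAlgClosed K]
    -- `V` is a smooth connected quasi-projective `K`-curve
    (V : Variety K) (hVqp : V.IsQuasiProjective) (hVsm : IsSmooth V.structMap)
    (hVconn : ConnectedSpace V.X) (hVdim : V.dim = 1)
    -- `φ : V' → V` is a flat morphism of quasi-projective varieties with dense image
    (V' : Variety K) (hV'qp : V'.IsQuasiProjective)
    (φ : V'.X ⟶ V.X) (hφ : φ ≫ V.structMap = V'.structMap)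
    (hflat : SchemeFlat φ) (hdense : Dense (Set.range φ.base))
    -- a finite group `G` acts on `V'` with `φ` invariant
    (G : Type) [Group G] [Finite G] (σ : ActionOn G V') (hinv : σ.Invariant φ)
    -- `W` is the (unique) smooth projective curve containing `V` as a dense open subvariety
    (W : Variety K) (hWproj : W.IsProjective) (hWsm : IsSmooth W.structMap)
    (hWconn : ConnectedSpace W.X) (hWdim : W.dim = 1)
    (j : V.X ⟶ W.X) (hj : IsOpenImmersion j) (hjK : j ≫ W.structMap = V.structMap)
    (hjdense : Dense (Set.range j.base)) :
    ∃ (W' : Variety K) (i' : V'.X ⟶ W'.X) (φbar : W'.X ⟶ W.X),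
      W'.IsProjective ∧
      IsPureOfDim W'.X V'.dim ∧
      IsImmersion i' ∧ i' ≫ W'.structMap = V'.structMap ∧
      φbar ≫ W.structMap = W'.structMap ∧
      SchemeFlat φbar ∧ Function.Surjective φbar.base ∧
      -- `φbar` extends `φ`
      i' ≫ φbar = φ ≫ j ∧
      -- every fibre of `φbar` is pure
      (∀ y : W.X, IsPure (fiber φbar y)) ∧
      -- the `G`-action extends, and `φbar` is invariant for it
      (∃ σbar : ActionOn G W',
        (∀ g : G, i' ≫ (σbar.ρ g).hom = (σ.ρ g).hom ≫ i') ∧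
        σbar.Invariant φbar) := by
  -- preliminaries on `W`
  have := W.reduced
  have := W.separated
  have := W.locallyOfFiniteType
  have := W.quasiCompact
  have := V'.reduced
  have := V'.separated
  have := V'.locallyOfFiniteType
  have := V'.quasiCompact
  have hWne : Nonempty W.X := inferInstance
  have hVne : Nonempty V.X := inferInstance
  have hV'ne : Nonempty V'.X := by
    obtain ⟨_, ⟨x, rfl⟩⟩ := hdense.nonempty
    exact ⟨x⟩
  have hWsm' : Smooth W.structMap := hWsm
  have hpid := stalk_pid W.structMap (height_le_of_dim W.structMap hWdim)
  have hWirr : IrreducibleSpace W.X :=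
    irreducible_of_domain_stalks W.structMap (fun x => (hpid x).1)
  let η : W.X := genericPoint W.X
  have hη : ∀ w, η ⤳ w := fun w => genericPoint_specializes w
  obtain ⟨n, i, hi, hiK⟩ := hV'qp
  obtain ⟨X, p0, p, hp, hex, hun, hXirr, N, e, heci, he⟩ :=
    exists_product n G W.structMap hWproj
  have hproper : IsProper (p0 ≫ W.structMap) := by
    rw [← he]; infer_instance
  let t : V'.X ⟶ W.X := φ ≫ j
  have ht : t ≫ W.structMap = V'.structMap := by
    rw [Category.assoc, hjK, hφ]
  obtain ⟨m, a, hmimm, hm0, hma, ha⟩ := exists_equivariant n W.structMap p0 p hp hex hun i t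
    (by rw [hiK, ht]) σ.ρ (fun g => by
      change (σ.ρ g).hom ≫ φ ≫ j = φ ≫ j
      rw [← Category.assoc, hinv g])
  obtain ⟨d, hd, hd1, hd2⟩ := exists_dim V'.structMap
  have hmK : m ≫ p0 ≫ W.structMap = V'.structMap := by
    rw [← Category.assoc, hm0, ht]
  have : LocallyOfFiniteType (m ≫ p0 ≫ W.structMap) := by rw [hmK]; infer_instance
  have : QuasiCompact (m ≫ p0 ≫ W.structMap) := by rw [hmK]; infer_instance
  have hmη : ∀ v : V'.X, (∀ w, w ⤳ v → w = v) → p0 (m v) = η := by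
    intro v hv
    rw [← Scheme.Hom.comp_apply, hm0, Scheme.Hom.comp_apply]
    have h1 : η ∈ Set.range j :=
      (hη (j (φ v))).mem_open j.isOpenEmbedding.isOpen_range ⟨_, rfl⟩
    obtain ⟨y, hy⟩ := h1
    have h2 : y ⤳ φ v := by
      rw [← j.isOpenEmbedding.isInducing.specializes_iff, hy]
      exact hη _
    rw [← flat_maximal φ hflat v hv y h2, hy]
  obtain ⟨C, hC, hmC, haC, hCmax⟩ := exists_closed (p0 ≫ W.structMap) m a p0 ha η hη hmη d hd1 hd2
  obtain ⟨Z, s, hs, hZred, hsC⟩ := exists_reduced_closed C hC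
  have hZproper : IsProper (s ≫ p0 ≫ W.structMap) := inferInstance
  have hZmax : ∀ z : Z, (∀ w, w ⤳ z → w = z) → (s ≫ p0) z = η ∧ Order.height z = d := by
    intro z hz
    obtain ⟨y, hyC, hy1, hy2, hy3⟩ := hCmax (s z) (by rw [← hsC]; exact ⟨z, rfl⟩)
    rw [← hsC] at hyC
    obtain ⟨z', rfl⟩ := hyC
    have h1 := hz z' (s.isEmbedding.specializes_iff.mp hy1)
    subst h1
    refine ⟨hy3, ?_⟩
    rw [← height_immersion s (p0 ≫ W.structMap)]
    exact hy2
  obtain ⟨i', hi'⟩ := exists_lift_closed s m (by rw [hsC]; exact hmC)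
  obtain ⟨b, hb⟩ := exists_action_lift s a (by rw [hsC]; exact haC)
  have hφK : (s ≫ p0) ≫ W.structMap = s ≫ p0 ≫ W.structMap := Category.assoc _ _ _
  have hZlft : LocallyOfFiniteType ((s ≫ p0) ≫ W.structMap) := by rw [hφK]; infer_instance
  let W' : Variety K :=
    { X := Z
      structMap := s ≫ p0 ≫ W.structMap
      reduced := hZred
      separated := inferInstance
      locallyOfFiniteType := inferInstance
      quasiCompact := inferInstance }
  refine ⟨W', i', s ≫ p0, ?_, ?_, ?_, ?_, ?_, ?_, ?_, ?_, ?_, ?_⟩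
  · refine ⟨N, s ≫ e, inferInstance, ?_⟩
    rw [Category.assoc, he]
  · intro T hT
    obtain ⟨x, hx1, hx2⟩ := component_height Z T hT
    rw [hx2]
    have h1 := (hZmax x hx1).2
    have h2 : @Order.height Z (specializationPreorder Z) x = d := h1
    rw [h2]
    exact hd.symm
  · have : IsImmersion (i' ≫ s) := by rw [hi']; infer_instance
    exact IsImmersion.of_comp i' s
  · change i' ≫ s ≫ p0 ≫ W.structMap = _
    rw [← Category.assoc, hi', hmK]
  · exact hφK
  · exact schemeFlat_of_reduced (s ≫ p0) η hη (fun v hv => (hZmax v hv).1) hpid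
  · have hpr : IsProper ((s ≫ p0) ≫ W.structMap) := by rw [hφK]; infer_instance
    have hpr' : IsProper (s ≫ p0) := IsProper.of_comp (s ≫ p0) W.structMap
    have hcl : IsClosed (Set.range (s ≫ p0)) := (s ≫ p0).isClosedMap.isClosed_range
    have hZne : Nonempty Z := ⟨i' (Classical.arbitrary _)⟩
    obtain ⟨z, -, -, hz⟩ := exists_maximal_ge (Classical.arbitrary Z)
    intro y
    have h1 : η ∈ Set.range (s ≫ p0) := ⟨z, (hZmax z hz).1⟩
    exact (hη y).mem_closed hcl h1
  · rw [← Category.assoc, hi', hm0]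
  · exact fun y => isPure_fiber (s ≫ p0) W.structMap η hη (fun y => (hpid y).2) d hZmax y
  · refine ⟨⟨b, fun g => ?_⟩, fun g => ?_, fun g => ?_⟩
    · change (b g).hom ≫ s ≫ p0 ≫ W.structMap = s ≫ p0 ≫ W.structMap
      rw [← Category.assoc, hb, Category.assoc, ← Category.assoc (a g).hom, ha]
    · rw [← cancel_mono s]
      change (i' ≫ (b g).hom) ≫ s = ((σ.ρ g).hom ≫ i') ≫ s
      rw [Category.assoc, hb, ← Category.assoc, hi', Category.assoc, hi', hma]
    · change (b g).hom ≫ s ≫ p0 = s ≫ p0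
      rw [← Category.assoc, hb, Category.assoc, ha]

end HLpaper
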